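/- arXiv:1512.03037 — 4 statements merged into one kernel-verified Lean document; each statement's English description precedes it below -/
import Mathlib

section
/- For every integer n ≥ 2, the maximum size s(Z_n, 3) of a 3-independent subset of the cyclic group Z_n is given as follows: if n is even, then s(Z_n,3) = ⌊n/4⌋; if n is odd and has at least one prime divisor congruent to 5 modulo 6, and p is the smallest such prime divisor, then s(Z_n,3) = (1 + 1/p)·n/6 = (p+1)·n/(6p); otherwise (n odd with no prime divisor congruent to 5 modulo 6), s(Z_n,3) = ⌊n/6⌋. -/
/-- A subset `A` of an (additive) abelian group is `t`-independent if whenever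
`λ₁a₁ + ⋯ + λₘaₘ = 0` with `a₁, …, aₘ` the (distinct) elements of `A` and
`|λ₁| + ⋯ + |λₘ| ≤ t`, all coefficients `λᵢ` vanish. -/
def IsTIndep {G : Type*} [AddCommGroup G] (t : ℕ) (A : Finset G) : Prop :=
  ∀ c : G → ℤ, (∀ x ∉ A, c x = 0) →
    (∑ x ∈ A, |c x|) ≤ (t : ℤ) →
    (∑ x ∈ A, c x • x) = 0 → ∀ x, c x = 0

/-- `sIndep G t` is the maximum size of a `t`-independent subset of `G`
(it is `0` if `G` has no nonempty `t`-independent subset, since `∅` is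
`t`-independent). -/
noncomputable def sIndep (G : Type*) [AddCommGroup G] (t : ℕ) : ℕ :=
  sSup {m | ∃ A : Finset G, IsTIndep t A ∧ A.card = m}

section

open Finset

/-- A weak form of Kneser's theorem, proved with the Dyson transform: a sumset contains a large
nonempty periodic set. -/
theorem exists_periodic_subset_of_zero_mem {G : Type*} [AddCommGroup G] [Finite G]
    [DecidableEq G] (N : ℕ) : ∀ A B : Finset G, #B = N → A.Nonempty → (0 : G) ∈ B →
    ∃ (H : AddSubgroup G) (C : Finset G), C.Nonempty ∧
      (∀ x ∈ C, ∃ a ∈ A, ∃ b ∈ B, a + b = x) ∧ (∀ x ∈ C, ∀ h ∈ H, x + h ∈ C) ∧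
      #A + #B ≤ #C + Nat.card H := by
  induction N using Nat.strong_induction_on with
  | _ N ih =>
  intro A B hB hA h0
  by_cases hper : ∀ e ∈ A, ∀ b ∈ B, e + b ∈ A
  · refine ⟨AddSubgroup.closure (B : Set G), A, hA, fun x hx => ⟨x, hx, 0, h0, add_zero x⟩,
      fun x hx h hh => ?_, ?_⟩
    · have hfin : ∀ b ∈ B, ∀ x, x + b ∈ A ↔ x ∈ A := by
        intro b hb x
        have himg : A.image (· + b) = A :=
          eq_of_subset_of_card_le (image_subset_iff.2 fun e he => hper e he b hb)
            (card_image_of_injective _ (add_left_injective b)).ge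
        constructor
        · intro hx
          rw [← himg] at hx
          obtain ⟨y, hy, hyx⟩ := mem_image.1 hx
          exact add_right_cancel hyx ▸ hy
        · exact fun hx => hper x hx b hb
      induction hh using AddSubgroup.closure_induction generalizing x with
      | mem b hb => exact (hfin b hb x).2 hx
      | zero => simpa using hx
      | add u v _ _ hu hv => rw [← add_assoc]; exact hv _ (hu _ hx)
      | neg u _ hu =>
        have hmaps : A.image (· + u) = A :=
          eq_of_subset_of_card_le (image_subset_iff.2 fun e he => hu e he)
            (card_image_of_injective _ (add_left_injective u)).ge
        rw [← hmaps] at hx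
        obtain ⟨y, hy, rfl⟩ := mem_image.1 hx
        simpa using hy
    · have : #B ≤ Nat.card (AddSubgroup.closure (B : Set G)) := by
        rw [← Set.ncard_coe_finset B, ← Nat.card_coe_set_eq]
        exact Nat.card_mono (Set.toFinite _) AddSubgroup.subset_closure
      omega
  · push Not at hper
    obtain ⟨e, he, b, hb, heb⟩ := hper
    have hlt : #(B.filter (e + · ∈ A)) < N := by
      rw [← hB]
      exact card_lt_card (filter_ssubset.2 ⟨b, hb, heb⟩)
    obtain ⟨H, C, hC, hsub, hH, hcard⟩ := ih _ hlt (A ∪ B.image (e + ·)) (B.filter (e + · ∈ A)) rfl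
      (hA.mono subset_union_left) (by simp [h0, he])
    refine ⟨H, C, hC, fun x hx => ?_, hH, ?_⟩
    · obtain ⟨u, hu, v, hv, rfl⟩ := hsub x hx
      rw [mem_filter] at hv
      rcases mem_union.1 hu with hu | hu
      · exact ⟨u, hu, v, hv.1, rfl⟩
      · obtain ⟨w, hw, rfl⟩ := mem_image.1 hu
        exact ⟨e + v, hv.2, w, hw, by abel⟩
    · have h1 := card_union_add_card_inter A (B.image (e + ·))
      have h2 : #(A ∩ B.image (e + ·)) = #(B.filter (e + · ∈ A)) := by
        rw [← card_image_of_injective (B.filter (e + · ∈ A)) (add_right_injective e)]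
        congr 1
        ext x
        simp only [mem_inter, mem_image, mem_filter]
        constructor
        · rintro ⟨hx, w, hw, rfl⟩
          exact ⟨w, ⟨hw, hx⟩, rfl⟩
        · rintro ⟨w, ⟨hw, hx⟩, rfl⟩
          exact ⟨hx, w, hw, rfl⟩
      rw [card_image_of_injective _ (add_right_injective e)] at h1
      omega

theorem exists_periodic_subset {G : Type*} [AddCommGroup G] [Finite G] [DecidableEq G]
    (A B : Finset G) (hA : A.Nonempty) (hB : B.Nonempty) :
    ∃ (H : AddSubgroup G) (C : Finset G), C.Nonempty ∧
      (∀ x ∈ C, ∃ a ∈ A, ∃ b ∈ B, a + b = x) ∧ (∀ x ∈ C, ∀ h ∈ H, x + h ∈ C) ∧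
      #A + #B ≤ #C + Nat.card H := by
  obtain ⟨b₀, hb₀⟩ := hB
  obtain ⟨H, C, hC, hsub, hH, hcard⟩ := exists_periodic_subset_of_zero_mem _ A
    (B.image (· - b₀)) rfl hA (mem_image.2 ⟨b₀, hb₀, sub_self b₀⟩)
  refine ⟨H, C.image (· + b₀), hC.image _, ?_, ?_, ?_⟩
  · intro x hx
    obtain ⟨y, hy, rfl⟩ := mem_image.1 hx
    obtain ⟨a, ha, b, hb, rfl⟩ := hsub y hy
    obtain ⟨b', hb', rfl⟩ := mem_image.1 hb
    exact ⟨a, ha, b', hb', by abel⟩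
  · intro x hx h hh
    obtain ⟨y, hy, rfl⟩ := mem_image.1 hx
    exact mem_image.2 ⟨y + h, hH y hy h hh, by abel⟩
  · rw [card_image_of_injective _ (sub_left_injective)] at hcard
    rwa [card_image_of_injective _ (add_left_injective b₀)]

/-- A symmetric set without solutions of `x + y + z = 0`. -/
def IsSymmTripleFree {G : Type*} [AddCommGroup G] (B : Finset G) : Prop :=
  (∀ x ∈ B, -x ∈ B) ∧ ∀ x ∈ B, ∀ y ∈ B, ∀ z ∈ B, x + y + z ≠ 0

section Fibers

variable {G : Type*} [AddCommGroup G] [Fintype G] (H : AddSubgroup G) [DecidableEq (G ⧸ H)]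

theorem card_coset (q : G ⧸ H) :
    #(univ.filter fun x : G => (x : G ⧸ H) = q) = Nat.card H := by
  obtain ⟨g, rfl⟩ := QuotientAddGroup.mk_surjective q
  classical
  rw [Nat.card_eq_fintype_card, ← Finset.card_univ]
  refine (card_bij (fun (h : H) _ => g + (h : G)) ?_ ?_ ?_).symm
  · intro h _
    simp
  · intro a _ b _ hab
    exact Subtype.ext (add_left_cancel hab)
  · intro b hb
    have hb : ((b : G) : G ⧸ H) = (g : G) := by simpa using hb
    refine ⟨⟨-g + b, QuotientAddGroup.eq.1 hb.symm⟩, mem_univ _, by simp⟩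

theorem card_fiber_le (B : Finset G) (q : G ⧸ H) :
    #(B.filter fun x : G => (x : G ⧸ H) = q) ≤ Nat.card H := by
  rw [← card_coset H q]
  exact card_le_card (filter_subset_filter _ (subset_univ B))

theorem card_le_card_mul_card_image_mk (B : Finset G) :
    #B ≤ Nat.card H * #(B.image (fun x : G => (x : G ⧸ H))) :=
  card_le_mul_card_image B _ fun q _ => card_fiber_le H B q

theorem IsSymmTripleFree.card_fiber_add_card_fiber_le [DecidableEq G] {B : Finset G}
    (hB : IsSymmTripleFree B)
    {x y z : G} (hz : z ∈ B) (hxyz : (x : G ⧸ H) + y + z = 0) :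
    #(B.filter fun u : G => (u : G ⧸ H) = x) + #(B.filter fun u : G => (u : G ⧸ H) = y)
      ≤ Nat.card H := by
  rw [← card_coset H (x : G ⧸ H),
    ← card_image_of_injective (B.filter fun u : G => (u : G ⧸ H) = y) (f := fun v => -z - v)
      sub_right_injective, ← card_union_of_disjoint]
  · refine card_le_card fun u hu => ?_
    rcases mem_union.1 hu with hu | hu
    · simpa using (mem_filter.1 hu).2
    · obtain ⟨v, hv, rfl⟩ := mem_image.1 hu
      rw [mem_filter] at hv
      simp only [mem_filter, mem_univ, true_and, QuotientAddGroup.mk_sub, QuotientAddGroup.mk_neg,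
        hv.2]
      rw [add_assoc] at hxyz
      rw [eq_neg_of_add_eq_zero_left hxyz]
      abel
  · rw [disjoint_left]
    intro u hu hu'
    obtain ⟨v, hv, rfl⟩ := mem_image.1 hu'
    exact hB.2 _ (mem_filter.1 hu).1 _ (mem_filter.1 hv).1 z hz (by abel)

theorem IsSymmTripleFree.card_add_card_le [DecidableEq G] {B : Finset G} (hB : IsSymmTripleFree B)
    {x y z : G} (hx : x ∈ B) (hy : y ∈ B) (hz : z ∈ B) (hxyz : (x : G ⧸ H) + y + z = 0)
    (hne : (x : G ⧸ H) ≠ y) :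
    #B + Nat.card H ≤ Nat.card H * #(B.image (fun x : G => (x : G ⧸ H))) := by
  set I := B.image (fun x : G => (x : G ⧸ H)) with hI
  have hxI : (x : G ⧸ H) ∈ I := mem_image_of_mem _ hx
  have hyI : (y : G ⧸ H) ∈ I.erase (x : G ⧸ H) := mem_erase.2 ⟨hne.symm, mem_image_of_mem _ hy⟩
  have hsum := card_eq_sum_card_image (fun x : G => (x : G ⧸ H)) B
  rw [← hI, ← add_sum_erase _ _ hxI, ← add_sum_erase _ _ hyI] at hsum
  have hpair := hB.card_fiber_add_card_fiber_le H hz hxyz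
  have hrest := sum_le_card_nsmul ((I.erase (x : G ⧸ H)).erase (y : G ⧸ H))
    (fun q => #(B.filter fun u : G => (u : G ⧸ H) = q)) (Nat.card H)
    fun q _ => card_fiber_le H B q
  have h1 := card_erase_add_one hyI
  have h2 := card_erase_add_one hxI
  rw [smul_eq_mul] at hrest
  rw [← h2, ← h1]
  linarith

end Fibers

theorem IsSymmTripleFree.card_le_of_maximal {G : Type*} [AddCommGroup G] [Fintype G]
    [DecidableEq G] {B : Finset G} (hB : IsSymmTripleFree B) (hne : B.Nonempty)
    (hmax : ∀ B' : Finset G, IsSymmTripleFree B' → #B' ≤ #B) :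
    3 * #B ≤ Fintype.card G ∨
      ∃ m, m ∣ Fintype.card G ∧ m % 3 = 2 ∧ 3 * m * #B ≤ Fintype.card G * (m + 1) := by
  classical
  obtain ⟨H, C, hC, hsub, hper, hcard⟩ := exists_periodic_subset B B hne hne
  set π : G → G ⧸ H := fun x => (x : G ⧸ H) with hπ
  set a := #(B.image π) with ha
  set c := #(C.image π) with hc
  set h := Nat.card H with hh
  set m := Nat.card (G ⧸ H) with hm
  have hn : Fintype.card G = m * h := by
    rw [← Nat.card_eq_fintype_card]
    exact AddSubgroup.card_eq_card_quotient_mul_card_addSubgroup H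
  have hpos : 0 < h := Nat.card_pos
  have hBa : #B ≤ h * a := card_le_card_mul_card_image_mk H B
  have hCc : #C ≤ h * c := card_le_card_mul_card_image_mk H C
  have hcpos : 0 < c := card_pos.2 (hC.image π)
  have hac : a + c ≤ m := by
    rw [ha, hc, ← card_union_of_disjoint, hm, Nat.card_eq_fintype_card]
    · exact card_le_univ _
    · rw [disjoint_left]
      rintro _ hq hq'
      obtain ⟨b, hb, rfl⟩ := mem_image.1 hq
      obtain ⟨x, hx, hxb⟩ := mem_image.1 hq'
      have hbC := hper x hx _ (QuotientAddGroup.eq.1 hxb)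
      rw [add_neg_cancel_left] at hbC
      obtain ⟨u, hu, v, hv, huv⟩ := hsub b hbC
      exact hB.2 u hu v hv (-b) (hB.1 b hb) (by rw [huv, add_neg_cancel])
  have hcard' : 2 * #B ≤ h * (c + 1) := by rw [mul_add]; omega
  rw [hn]
  obtain ⟨k, hk⟩ : ∃ k, m = 3 * k ∨ m = 3 * k + 1 ∨ m = 3 * k + 2 := ⟨m / 3, by omega⟩
  have hkm : h * (3 * k) ≤ h * m := Nat.mul_le_mul_left h (by omega)
  by_cases hak : a ≤ k
  · left
    nlinarith [Nat.mul_le_mul_left h hak]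
  by_cases hck : c + 1 ≤ 2 * k
  · left
    nlinarith [Nat.mul_le_mul_left h hck]
  rcases hk with hk | hk | hk
  · omega
  · have hak' : a = k + 1 := by omega
    have hck' : c = 2 * k := by omega
    left
    by_cases hcl : IsSymmTripleFree (univ.filter fun x : G => π x ∈ B.image π)
    · exfalso
      have h1 := hmax _ hcl
      have h2 : #(univ.filter fun x : G => π x ∈ B.image π) = h * a := by
        have := card_eq_sum_card_fiberwise (f := π)
          (s := univ.filter fun x : G => π x ∈ B.image π) (t := B.image π)
          (by intro x hx; simpa using hx)
        rw [this, sum_congr rfl (g := fun _ => h), sum_const, smul_eq_mul, mul_comm]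
        intro q hq
        rw [filter_filter, hh, ← card_coset H q]
        congr 1
        ext x
        simp only [mem_filter, mem_univ, true_and, hπ]
        constructor
        · exact fun hx => hx.2
        · rintro rfl
          exact ⟨hq, rfl⟩
      rw [h2] at h1
      have : 2 * (h * (k + 1)) ≤ h * (2 * k + 1) := by
        rw [hak'] at h1; rw [hck'] at hcard'; omega
      nlinarith
    · suffices hbig : #B + h ≤ h * a by
        rw [hak'] at hbig; rw [hk]; nlinarith
      obtain ⟨x, hx, y, hy, z, hz, hxyz⟩ :
          ∃ x ∈ B, ∃ y ∈ B, ∃ z ∈ B, π x + π y + π z = 0 := by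
        by_contra! hcon
        refine hcl ⟨fun x hx => ?_, fun x hx y hy z hz hsum => ?_⟩
        · simp only [mem_filter, mem_univ, true_and] at hx ⊢
          obtain ⟨b, hb, hbx⟩ := mem_image.1 hx
          exact mem_image.2 ⟨-b, hB.1 b hb, by simp [hπ] at hbx ⊢; exact hbx⟩
        · simp only [mem_filter, mem_univ, true_and] at hx hy hz
          obtain ⟨x', hx', hxx⟩ := mem_image.1 hx
          obtain ⟨y', hy', hyy⟩ := mem_image.1 hy
          obtain ⟨z', hz', hzz⟩ := mem_image.1 hz
          refine hcon x' hx' y' hy' z' hz' ?_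
          rw [hxx, hyy, hzz]
          simp only [hπ, ← QuotientAddGroup.mk_add, hsum, QuotientAddGroup.mk_zero]
      by_cases hxy : π x = π y
      · by_cases hyz : π y = π z
        · have hx0 : π x = 0 := by
            have h3 : (3 : ℕ) • π x = 0 := by
              rw [← hxyz, ← hyz, ← hxy]; abel
            have hmx : m • π x = 0 := card_nsmul_eq_zero'
            rw [hk, add_nsmul, mul_comm, mul_nsmul', h3, nsmul_zero, zero_add, one_nsmul] at hmx
            exact hmx
          obtain ⟨q, hq, hq0⟩ : ∃ q ∈ B.image π, q ≠ π x :=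
            exists_mem_ne (by omega) _
          obtain ⟨w, hw, rfl⟩ := mem_image.1 hq
          refine hB.card_add_card_le H hx hw (hB.1 w hw) ?_ hq0.symm
          change π x + π w + π (-w) = 0
          rw [hx0, zero_add]
          exact add_neg_cancel (π w)
        · exact hB.card_add_card_le H hy hz hx (by rw [← hxyz]; abel) hyz
      · exact hB.card_add_card_le H hx hy hz hxyz hxy
  · right
    refine ⟨m, dvd_mul_right m h, by omega, ?_⟩
    have : 3 * #B ≤ h * (m + 1) := by
      have h1 : h * (a + (c + 1)) ≤ h * (m + 1) := Nat.mul_le_mul_left h (by omega)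
      rw [mul_add] at h1
      omega
    nlinarith

theorem IsSymmTripleFree.card_le {G : Type*} [AddCommGroup G] [Fintype G]
    [DecidableEq G] {B : Finset G} (hB : IsSymmTripleFree B) :
    3 * #B ≤ Fintype.card G ∨
      ∃ m, m ∣ Fintype.card G ∧ m % 3 = 2 ∧ 3 * m * #B ≤ Fintype.card G * (m + 1) := by
  classical
  obtain ⟨M, hM, hmax⟩ := exists_max_image (univ.filter fun B : Finset G => IsSymmTripleFree B)
    card ⟨B, by simpa using hB⟩
  simp only [mem_filter, mem_univ, true_and] at hM hmax
  have hBM := hmax B hB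
  rcases M.eq_empty_or_nonempty with rfl | hne
  · left
    rw [card_empty] at hBM
    omega
  · rcases hM.card_le_of_maximal hne hmax with h | ⟨m, hm, hm3, h⟩
    · left; omega
    · exact Or.inr ⟨m, hm, hm3, (Nat.mul_le_mul_left _ hBM).trans h⟩

theorem IsSymmTripleFree.two_mul_card_le {G : Type*} [AddCommGroup G] [Fintype G]
    [DecidableEq G] {B : Finset G} (hB : IsSymmTripleFree B) : 2 * #B ≤ Fintype.card G := by
  rcases B.eq_empty_or_nonempty with rfl | ⟨b, hb⟩
  · simp
  rw [two_mul]
  nth_rewrite 2 [← card_image_of_injective B (add_right_injective b)]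
  rw [← card_union_of_disjoint]
  · exact card_le_univ _
  · rw [disjoint_left]
    intro x hx hx'
    obtain ⟨y, hy, rfl⟩ := mem_image.1 hx'
    exact hB.2 b hb y hy _ (hB.1 _ hx) (by simp)

theorem isTIndep_three_iff {G : Type*} [AddCommGroup G] (A : Finset G) :
    IsTIndep 3 A ↔ (∀ x ∈ A, ∀ y ∈ A, x + y ≠ 0) ∧ (∀ x ∈ A, ∀ y ∈ A, ∀ z ∈ A, x + y + z ≠ 0) ∧
      ∀ x ∈ A, ∀ y ∈ A, ∀ z ∈ A, x + y ≠ z := by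
  classical
  have habs : ∀ u ∈ A, ∑ x ∈ A, |(Pi.single u 1 : G → ℤ) x| = 1 := by
    intro u hu
    rw [sum_eq_single_of_mem u hu fun v _ hv => by simp [Pi.single_eq_of_ne hv]]
    simp
  have hsmul : ∀ u ∈ A, ∑ x ∈ A, (Pi.single u 1 : G → ℤ) x • x = u := by
    intro u hu
    rw [sum_eq_single_of_mem u hu fun v _ hv => by simp [Pi.single_eq_of_ne hv]]
    simp
  have hsupp : ∀ u ∈ A, ∀ x ∉ A, (Pi.single u 1 : G → ℤ) x = 0 :=
    fun u hu x hx => Pi.single_eq_of_ne (fun h : x = u => hx (h ▸ hu)) _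
  have hnn : ∀ u x : G, 0 ≤ (Pi.single u 1 : G → ℤ) x := by
    intro u x
    rw [Pi.single_apply]
    split_ifs <;> simp
  constructor
  · intro h
    refine ⟨fun x hx y hy hxy => ?_, fun x hx y hy z hz hxyz => ?_, fun x hx y hy z hz hxyz => ?_⟩
    · have := h (fun u => (Pi.single x 1 : G → ℤ) u + (Pi.single y 1 : G → ℤ) u)
        (fun u hu => by simp [hsupp x hx u hu, hsupp y hy u hu])
        (by
          refine (sum_le_sum fun u _ => abs_add_le _ _).trans ?_
          rw [sum_add_distrib, habs x hx, habs y hy]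
          norm_num)
        (by simp_rw [add_smul]; rw [sum_add_distrib, hsmul x hx, hsmul y hy, hxy]) x
      have h2 := hnn y x
      simp only [Pi.single_eq_same] at this
      omega
    · have := h (fun u => (Pi.single x 1 : G → ℤ) u + (Pi.single y 1 : G → ℤ) u +
          (Pi.single z 1 : G → ℤ) u)
        (fun u hu => by simp [hsupp x hx u hu, hsupp y hy u hu, hsupp z hz u hu])
        (by
          refine (sum_le_sum fun u _ => abs_add_three _ _ _).trans ?_
          rw [sum_add_distrib, sum_add_distrib, habs x hx, habs y hy, habs z hz]
          norm_num)
        (by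
          simp_rw [add_smul]
          rw [sum_add_distrib, sum_add_distrib, hsmul x hx, hsmul y hy, hsmul z hz, hxyz]) x
      have h2 := hnn y x
      have h3 := hnn z x
      simp only [Pi.single_eq_same] at this
      omega
    · have := h (fun u => (Pi.single x 1 : G → ℤ) u + (Pi.single y 1 : G → ℤ) u +
          -(Pi.single z 1 : G → ℤ) u)
        (fun u hu => by simp [hsupp x hx u hu, hsupp y hy u hu, hsupp z hz u hu])
        (by
          refine (sum_le_sum fun u _ => abs_add_three _ _ _).trans ?_
          simp_rw [abs_neg]
          rw [sum_add_distrib, sum_add_distrib, habs x hx, habs y hy, habs z hz]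
          norm_num)
        (by
          simp_rw [add_smul, neg_smul]
          rw [sum_add_distrib, sum_add_distrib, sum_neg_distrib, hsmul x hx, hsmul y hy,
            hsmul z hz, hxyz, add_neg_cancel])
      by_cases hxz : x = z
      · have hy1 := this y
        simp [hxz] at hy1
      · have hx1 := this x
        have h2 := hnn y x
        simp only [Pi.single_eq_same, Pi.single_eq_of_ne hxz] at hx1
        omega
  · rintro ⟨h2, h3, h21⟩ c hc hsum hzero
    by_contra! hne
    obtain ⟨w, hw⟩ := hne
    have hwA : w ∈ A := by
      by_contra hwA
      exact hw (hc w hwA)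
    set P : Multiset G := ∑ x ∈ A, (c x).toNat • {x} with hP
    set Q : Multiset G := ∑ x ∈ A, (-c x).toNat • {x} with hQ
    have hmemP : ∀ x ∈ P, x ∈ A ∧ 0 < c x := by
      intro x hx
      obtain ⟨y, hy, hxy⟩ := Multiset.mem_sum.1 hx
      have h1 := Multiset.mem_singleton.1 (Multiset.mem_of_mem_nsmul hxy)
      subst h1
      refine ⟨hy, ?_⟩
      by_contra hcon
      rw [Int.toNat_of_nonpos (by omega)] at hxy
      simp at hxy
    have hmemQ : ∀ x ∈ Q, x ∈ A ∧ c x < 0 := by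
      intro x hx
      obtain ⟨y, hy, hxy⟩ := Multiset.mem_sum.1 hx
      have h1 := Multiset.mem_singleton.1 (Multiset.mem_of_mem_nsmul hxy)
      subst h1
      refine ⟨hy, ?_⟩
      by_contra hcon
      rw [Int.toNat_of_nonpos (by omega)] at hxy
      simp at hxy
    have hcardPQ : ((P.card + Q.card : ℕ) : ℤ) = ∑ x ∈ A, |c x| := by
      rw [hP, hQ, Multiset.card_sum, Multiset.card_sum, ← sum_add_distrib]
      push_cast
      refine sum_congr rfl fun x _ => ?_
      simp only [Multiset.card_nsmul, Multiset.card_singleton]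
      rcases abs_cases (c x) with h | h <;> omega
    have hle : P.card + Q.card ≤ 3 := by
      rw [← hcardPQ] at hsum
      exact_mod_cast hsum
    have hpos : 0 < P.card + Q.card := by
      have : 0 < ∑ x ∈ A, |c x| := sum_pos' (fun _ _ => abs_nonneg _) ⟨w, hwA, abs_pos.2 hw⟩
      rw [← hcardPQ] at this
      exact_mod_cast this
    have hPQ : P.sum = Q.sum := by
      have hs : ∀ f : G → ℕ, (∑ x ∈ A, f x • ({x} : Multiset G)).sum = ∑ x ∈ A, f x • x := by
        intro f
        rw [← Multiset.coe_sumAddMonoidHom, map_sum]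
        simp [Multiset.sum_nsmul]
      rw [hP, hQ, hs, hs, ← sub_eq_zero, ← sum_sub_distrib, ← hzero]
      refine sum_congr rfl fun x _ => ?_
      rw [← natCast_zsmul, ← natCast_zsmul, ← sub_smul]
      congr 1
      omega
    have key : ∀ P Q : Multiset G, (∀ x ∈ P, x ∈ A) → (∀ x ∈ Q, x ∈ A) →
        (∀ x ∈ P, x ∉ Q) → P.sum = Q.sum → Q.card ≤ P.card → 0 < P.card + Q.card →
        P.card + Q.card ≤ 3 → False := by
      intro P Q hPA hQA hdisj hs hcmp hpos hle
      have hPc : P.card = 1 ∨ P.card = 2 ∨ P.card = 3 := by omega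
      have hQc : Q.card = 0 ∨ Q.card = 1 := by omega
      have hz : ∀ x ∈ A, x ≠ 0 := by
        rintro x hx rfl
        exact h2 0 hx 0 hx (add_zero 0)
      rcases hQc with hQc | hQc
      · rw [Multiset.card_eq_zero] at hQc
        subst hQc
        rcases hPc with hPc | hPc | hPc
        · obtain ⟨x, rfl⟩ := Multiset.card_eq_one.1 hPc
          exact hz x (hPA x (by simp)) (by simpa using hs)
        · obtain ⟨x, y, rfl⟩ := Multiset.card_eq_two.1 hPc
          exact h2 x (hPA x (by simp)) y (hPA y (by simp)) (by simpa using hs)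
        · obtain ⟨x, y, z, rfl⟩ := Multiset.card_eq_three.1 hPc
          exact h3 x (hPA x (by simp)) y (hPA y (by simp)) z (hPA z (by simp))
            (by simpa [add_assoc] using hs)
      · obtain ⟨z, rfl⟩ := Multiset.card_eq_one.1 hQc
        rcases hPc with hPc | hPc | hPc
        · obtain ⟨x, rfl⟩ := Multiset.card_eq_one.1 hPc
          exact hdisj x (by simp) (by simpa using hs)
        · obtain ⟨x, y, rfl⟩ := Multiset.card_eq_two.1 hPc
          exact h21 x (hPA x (by simp)) y (hPA y (by simp)) z (hQA z (by simp))
            (by simpa using hs)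
        · omega
    rcases le_total Q.card P.card with hcmp | hcmp
    · exact key P Q (fun x hx => (hmemP x hx).1) (fun x hx => (hmemQ x hx).1)
        (fun x hx hx' => by have := (hmemP x hx).2; have := (hmemQ x hx').2; omega)
        hPQ hcmp hpos hle
    · exact key Q P (fun x hx => (hmemQ x hx).1) (fun x hx => (hmemP x hx).1)
        (fun x hx hx' => by have := (hmemQ x hx).2; have := (hmemP x hx').2; omega)
        hPQ.symm hcmp (by omega) (by omega)

theorem IsTIndep.exists_isSymmTripleFree {G : Type*} [AddCommGroup G] [DecidableEq G]
    {A : Finset G} (hA : IsTIndep 3 A) :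
    ∃ B : Finset G, IsSymmTripleFree B ∧ #B = 2 * #A := by
  obtain ⟨h2, h3, h21⟩ := (isTIndep_three_iff A).1 hA
  refine ⟨A ∪ A.image (- ·), ⟨fun x hx => ?_, fun x hx y hy z hz hxyz => ?_⟩, ?_⟩
  · rcases mem_union.1 hx with hx | hx
    · exact mem_union_right _ (mem_image_of_mem _ hx)
    · obtain ⟨y, hy, rfl⟩ := mem_image.1 hx
      exact mem_union_left _ (by simpa using hy)
  · simp only [mem_union, mem_image] at hx hy hz
    have hneg := congrArg Neg.neg hxyz
    rcases hx with hx | ⟨x, hx, rfl⟩ <;> rcases hy with hy | ⟨y, hy, rfl⟩ <;>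
      rcases hz with hz | ⟨z, hz, rfl⟩
    · exact h3 x hx y hy z hz hxyz
    · exact h21 x hx y hy z hz (by rwa [← sub_eq_add_neg, sub_eq_zero] at hxyz)
    · exact h21 x hx z hz y hy (by rw [← sub_eq_zero, ← hxyz]; abel)
    · exact h21 y hy z hz x hx (by rw [← sub_eq_zero, ← neg_zero, ← hxyz]; abel)
    · exact h21 y hy z hz x hx (by rw [← sub_eq_zero, ← hxyz]; abel)
    · exact h21 x hx z hz y hy (by rw [← sub_eq_zero, ← neg_zero, ← hxyz]; abel)
    · exact h21 x hx y hy z hz (by rw [← sub_eq_zero, ← neg_zero, ← hxyz]; abel)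
    · exact h3 x hx y hy z hz (by rw [← neg_zero, ← hxyz]; abel)
  · rw [card_union_of_disjoint, card_image_of_injective _ neg_injective, two_mul]
    rw [disjoint_left]
    intro x hx hx'
    obtain ⟨y, hy, rfl⟩ := mem_image.1 hx'
    exact h2 _ hx y hy (neg_add_cancel y)

theorem isTIndep_three_image_cast {n : ℕ} {ι : Type*} (s : Finset ι) (f : ι → ℕ)
    (h2 : ∀ x ∈ s, ∀ y ∈ s, ¬ n ∣ f x + f y)
    (h3 : ∀ x ∈ s, ∀ y ∈ s, ∀ z ∈ s, ¬ n ∣ f x + f y + f z)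
    (h21 : ∀ x ∈ s, ∀ y ∈ s, ∀ z ∈ s, ¬ f x + f y ≡ f z [MOD n]) :
    IsTIndep 3 (s.image fun i => (f i : ZMod n)) := by
  rw [isTIndep_three_iff]
  simp only [forall_mem_image]
  refine ⟨fun x hx y hy h => h2 x hx y hy ?_, fun x hx y hy z hz h => h3 x hx y hy z hz ?_,
    fun x hx y hy z hz h => h21 x hx y hy z hz ?_⟩
  · exact (ZMod.natCast_eq_zero_iff _ _).1 (by exact_mod_cast h)
  · exact (ZMod.natCast_eq_zero_iff _ _).1 (by exact_mod_cast h)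
  · exact (ZMod.natCast_eq_natCast_iff _ _ _).1 (by exact_mod_cast h)

theorem card_image_cast {n : ℕ} {ι : Type*} (s : Finset ι) (f : ι → ℕ) (hf : Set.InjOn f s)
    (hlt : ∀ x ∈ s, f x < n) : #(s.image fun i => (f i : ZMod n)) = #s := by
  refine card_image_of_injOn fun x hx y hy hxy => hf hx hy ?_
  have := (ZMod.natCast_eq_natCast_iff' _ _ _).1 hxy
  rwa [Nat.mod_eq_of_lt (hlt x hx), Nat.mod_eq_of_lt (hlt y hy)] at this

theorem sIndep_three_eq {n : ℕ} [NeZero n] {m : ℕ}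
    (hlow : ∃ A : Finset (ZMod n), IsTIndep 3 A ∧ #A = m)
    (hup : ∀ B : Finset (ZMod n), IsSymmTripleFree B → #B < 2 * (m + 1)) :
    sIndep (ZMod n) 3 = m := by
  refine IsGreatest.csSup_eq ⟨hlow, ?_⟩
  rintro _ ⟨A, hA, rfl⟩
  obtain ⟨B, hB, hBA⟩ := hA.exists_isSymmTripleFree
  have := hup B hB
  omega

theorem sIndep_three_of_even {n : ℕ} [NeZero n] (hn : Even n) : sIndep (ZMod n) 3 = n / 4 := by
  obtain ⟨k, hk⟩ := hn
  refine sIndep_three_eq ⟨_, isTIndep_three_image_cast (range (n / 4)) (2 * · + 1) ?_ ?_ ?_, ?_⟩ ?_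
  · intro x hx y hy h
    rw [mem_range] at hx hy
    have := Nat.le_of_dvd (by omega) h
    omega
  · intro x _ y _ z _ h
    have : 2 ∣ n := ⟨k, by omega⟩
    have := this.trans h
    omega
  · intro x _ y _ z _ h
    have := h.of_dvd (show 2 ∣ n from ⟨k, by omega⟩)
    simp only [Nat.ModEq] at this
    omega
  · rw [card_image_cast, card_range]
    · intro x _ y _ hxy
      simpa using hxy
    · intro x hx
      rw [mem_range] at hx
      omega
  · intro B hB
    have := hB.two_mul_card_le
    rw [ZMod.card] at this
    omega

theorem exists_prime_dvd_mod_six_eq_five {m : ℕ} (hodd : m % 2 = 1) (hm : m % 3 = 2) :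
    ∃ p, p.Prime ∧ p ∣ m ∧ p % 6 = 5 := by
  induction m using Nat.strong_induction_on with
  | _ m ih =>
  obtain ⟨q, hq, k, rfl⟩ := Nat.exists_prime_and_dvd (n := m) (by omega)
  by_cases hq5 : q % 6 = 5
  · exact ⟨q, hq, dvd_mul_right q k, hq5⟩
  have hq2 : q % 2 = 1 ∧ k % 2 = 1 := by
    rw [Nat.mul_mod] at hodd
    rcases Nat.mod_two_eq_zero_or_one q with h | h <;>
      rcases Nat.mod_two_eq_zero_or_one k with h' | h' <;> simp_all
  have hk3 : k % 3 = 2 := by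
    have h1 : q % 3 = 0 ∨ q % 3 = 1 := by omega
    have h2 : k % 3 = 0 ∨ k % 3 = 1 ∨ k % 3 = 2 := by omega
    rw [Nat.mul_mod] at hm
    rcases h1 with h1 | h1 <;> rcases h2 with h2 | h2 | h2 <;> simp_all
  have hlt : k < q * k := by
    have := hq.two_le
    nlinarith [show 0 < k by omega]
  obtain ⟨p, hp, hpk, hp5⟩ := ih k hlt hq2.2 hk3
  exact ⟨p, hp, hpk.mul_left q, hp5⟩

theorem sIndep_three_of_odd_of_prime {n : ℕ} [NeZero n] {k : ℕ} {r : ℕ} (hodd : Odd n)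
    (hn : n = (6 * k + 5) * r)
    (hmin : ∀ q : ℕ, q.Prime → q ∣ n → q % 6 = 5 → 6 * k + 5 ≤ q) :
    sIndep (ZMod n) 3 = (k + 1) * r := by
  have hdvd : 6 * k + 5 ∣ n := ⟨r, hn⟩
  have hmod : ∀ i j, (i * (6 * k + 5) + j) ≡ j [MOD 6 * k + 5] := fun i j => by
    simp [Nat.ModEq]
  have key : ∀ t, 0 < t → t < 6 * k + 5 → ¬ t ≡ 0 [MOD 6 * k + 5] := by
    intro t h0 h1 h
    have := h.eq_of_lt_of_lt h1 (by omega)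
    omega
  have hr : 0 < r := Nat.pos_of_ne_zero fun h => NeZero.ne n (by rw [hn, h, mul_zero])
  refine sIndep_three_eq ⟨_, isTIndep_three_image_cast (range r ×ˢ range (k + 1))
    (fun x => x.1 * (6 * k + 5) + (2 * k + 2 + x.2)) ?_ ?_ ?_, ?_⟩ ?_
  · rintro ⟨i, u⟩ hx ⟨j, v⟩ hy h
    simp only [mem_product, mem_range] at hx hy
    refine key (2 * k + 2 + u + (2 * k + 2 + v)) (by omega) (by omega) ?_
    exact ((hmod i _).add (hmod j _)).symm.trans (Nat.modEq_zero_iff_dvd.2 (hdvd.trans h))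
  · rintro ⟨i, u⟩ hx ⟨j, v⟩ hy ⟨l, w⟩ hz h
    simp only [mem_product, mem_range] at hx hy hz
    refine key (u + v + w + 1) (by omega) (by omega) ?_
    have h1 := (((hmod i _).add (hmod j _)).add (hmod l _)).symm.trans
      (Nat.modEq_zero_iff_dvd.2 (hdvd.trans h))
    have h2 : 2 * k + 2 + u + (2 * k + 2 + v) + (2 * k + 2 + w) =
      1 * (6 * k + 5) + (u + v + w + 1) := by ring
    rw [h2] at h1
    exact (hmod 1 _).symm.trans h1
  · rintro ⟨i, u⟩ hx ⟨j, v⟩ hy ⟨l, w⟩ hz h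
    simp only [mem_product, mem_range] at hx hy hz
    have h1 := ((hmod i _).add (hmod j _)).symm.trans ((h.of_dvd hdvd).trans (hmod l _))
    have := h1.eq_of_lt_of_lt (by omega) (by omega)
    omega
  · rw [card_image_cast, card_product, card_range, card_range, mul_comm]
    · rintro ⟨i, u⟩ hx ⟨j, v⟩ hy hxy
      simp only [coe_product, Set.mem_prod, mem_coe, mem_range] at hx hy hxy
      have h1 := (hmod i _).symm.trans (hxy ▸ hmod j _)
      have h2 := h1.eq_of_lt_of_lt (by omega) (by omega)
      have h3 : i * (6 * k + 5) = j * (6 * k + 5) := by omega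
      have h4 := Nat.eq_of_mul_eq_mul_right (by omega) h3
      ext <;> simp only <;> omega
    · rintro ⟨i, u⟩ hx
      simp only [mem_product, mem_range] at hx
      rw [hn]
      nlinarith [Nat.mul_le_mul_right (6 * k + 5) (show i + 1 ≤ r from hx.1)]
  · intro B hB
    suffices 3 * #B ≤ 3 * (2 * ((k + 1) * r)) by omega
    rcases hB.card_le with h | ⟨m, hm, hm3, h⟩
    · rw [ZMod.card] at h
      nlinarith
    · rw [ZMod.card] at hm h
      obtain ⟨q, hq, hqm, hq5⟩ := exists_prime_dvd_mod_six_eq_five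
        (Nat.odd_iff.1 (hodd.of_dvd_nat hm)) hm3
      have hpm : 6 * k + 5 ≤ m :=
        (hmin q hq (hqm.trans hm) hq5).trans (Nat.le_of_dvd (by omega) hqm)
      refine Nat.le_of_mul_le_mul_left (c := m) ?_ (by omega)
      have hnm : n * (m + 1) = (6 * k + 5) * r * (m + 1) := congrArg (· * (m + 1)) hn
      nlinarith [Nat.mul_le_mul_left r hpm]

theorem sIndep_three_of_odd {n : ℕ} [NeZero n] (hodd : Odd n)
    (hno : ∀ p : ℕ, p.Prime → p ∣ n → p % 6 ≠ 5) : sIndep (ZMod n) 3 = n / 6 := by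
  have hodd' := Nat.odd_iff.1 hodd
  have hn3 : n % 3 ≠ 2 := fun h => by
    obtain ⟨p, hp, hpn, hp5⟩ := exists_prime_dvd_mod_six_eq_five hodd' h
    exact hno p hp hpn hp5
  refine sIndep_three_eq ⟨_, isTIndep_three_image_cast (range (n / 6)) (n / 3 + 1 + ·)
    ?_ ?_ ?_, ?_⟩ ?_
  · intro x hx y hy h
    rw [mem_range] at hx hy
    have := Nat.le_of_dvd (by omega) h
    omega
  · rintro x hx y hy z hz ⟨c, hc⟩
    rw [mem_range] at hx hy hz
    have h1 : 1 < c := by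
      by_contra hcon
      have := Nat.mul_le_mul_left n (show c ≤ 1 by omega)
      omega
    have := Nat.mul_le_mul_left n (show 2 ≤ c by omega)
    omega
  · intro x hx y hy z hz h
    rw [mem_range] at hx hy hz
    have := h.eq_of_lt_of_lt (by omega) (by omega)
    omega
  · rw [card_image_cast, card_range]
    · intro x _ y _ hxy
      simpa using hxy
    · intro x hx
      rw [mem_range] at hx
      omega
  · intro B hB
    rcases hB.card_le with h | ⟨m, hm, hm3, -⟩
    · rw [ZMod.card] at h
      omega
    · rw [ZMod.card] at hm
      obtain ⟨p, hp, hpm, hp5⟩ := exists_prime_dvd_mod_six_eq_five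
        (Nat.odd_iff.1 (hodd.of_dvd_nat hm)) hm3
      exact absurd hp5 (hno p hp (hpm.trans hm))

end

theorem stmt3 (n : ℕ) (hn : 2 ≤ n) :
    (Even n → sIndep (ZMod n) 3 = n / 4) ∧
    (Odd n → ∀ p : ℕ, p.Prime → p ∣ n → p % 6 = 5 →
      (∀ q : ℕ, q.Prime → q ∣ n → q % 6 = 5 → p ≤ q) →
      (sIndep (ZMod n) 3 : ℚ) = (1 + 1 / (p : ℚ)) * (n : ℚ) / 6) ∧
    (Odd n → (∀ p : ℕ, p.Prime → p ∣ n → p % 6 ≠ 5) →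
      sIndep (ZMod n) 3 = n / 6) := by
  have : NeZero n := ⟨by omega⟩
  refine ⟨sIndep_three_of_even, fun hodd p hp hpn hp5 hmin => ?_, sIndep_three_of_odd⟩
  obtain ⟨r, hr⟩ := hpn
  obtain ⟨k, rfl⟩ : ∃ k, p = 6 * k + 5 := ⟨p / 6, by omega⟩
  rw [sIndep_three_of_odd_of_prime hodd hr hmin]
  have hne : (6 * (k : ℚ) + 5) ≠ 0 := by positivity
  rw [hr]
  push_cast
  field_simp
  ring
end

section
/- Let G be a finite abelian group of order n ≥ 2, and suppose that no divisor of n is congruent to 2 modulo 3. Then every 3-independent subset A of G satisfies |A| ≤ n/6. -/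
namespace SumFree

open Finset
open scoped Pointwise

section Isoperimetric

variable {G : Type*} [AddCommGroup G] [DecidableEq G]

/-- Submodularity of `X ↦ |X + S|`. -/
theorem card_inter_add_card_union_add_le (X Y S : Finset G) :
    (X ∩ Y + S).card + (X ∪ Y + S).card ≤ (X + S).card + (Y + S).card := by
  have h1 : X ∩ Y + S ⊆ (X + S) ∩ (Y + S) := Finset.inter_add_subset
  have h2 := Finset.card_le_card h1
  have h3 := Finset.card_union_add_card_inter (X + S) (Y + S)
  rw [Finset.union_add]
  omega

variable [Fintype G]

/-- If `S` is symmetric, the complement of `X + S` has boundary no larger than that of `X`. -/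
theorem card_compl_add_add_card_le {S : Finset G} (hsymm : ∀ x ∈ S, -x ∈ S) (X : Finset G) :
    ((X + S)ᶜ + S).card + X.card ≤ Fintype.card G := by
  have h : Disjoint ((X + S)ᶜ + S) X := by
    rw [Finset.disjoint_left]
    intro x hx hxX
    obtain ⟨y, hy, s, hs, rfl⟩ := Finset.mem_add.1 hx
    refine (Finset.mem_compl.1 hy) ?_
    have := Finset.add_mem_add hxX (hsymm s hs)
    simpa using this
  rw [← Finset.card_union_of_disjoint h]
  exact Finset.card_le_univ _

/-- For symmetric `S`, the minimum of `|X + S| - |X|` over nonempty `X` with `X + S ≠ G` is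
attained by a subgroup. -/
theorem exists_addSubgroup_card_add_le {S X₀ : Finset G}
    (hsymm : ∀ x ∈ S, -x ∈ S) (hX₀ : X₀.Nonempty) (hX₀S : X₀ + S ≠ univ) :
    ∃ (H : AddSubgroup G) (K : Finset G), (∀ x, x ∈ K ↔ x ∈ H) ∧ K + S ≠ univ ∧
      (K + S).card + X₀.card ≤ (X₀ + S).card + K.card := by
  classical
  let F : Finset (Finset G) := univ.filter fun X => X.Nonempty ∧ X + S ≠ univ
  have memF : ∀ X, X ∈ F ↔ X.Nonempty ∧ X + S ≠ univ := by simp [F]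
  obtain ⟨M, hMF, hM⟩ := F.exists_min_image (fun X => ((X + S).card : ℤ) - X.card)
    ⟨X₀, (memF _).2 ⟨hX₀, hX₀S⟩⟩
  obtain ⟨A, hAE, hA⟩ := (F.filter fun X => ((X + S).card : ℤ) - X.card
    = (M + S).card - M.card).exists_min_image Finset.card ⟨M, by simp [hMF]⟩
  rw [Finset.mem_filter] at hAE
  obtain ⟨hAF, hAM⟩ := hAE
  have hmin : ∀ X, X.Nonempty → X + S ≠ univ →
      ((A + S).card : ℤ) - A.card ≤ (X + S).card - X.card := by
    intro X h1 h2
    rw [hAM]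
    exact hM X ((memF _).2 ⟨h1, h2⟩)
  have hmin' : ∀ X, X.Nonempty → X + S ≠ univ →
      ((X + S).card : ℤ) - X.card ≤ (A + S).card - A.card → A.card ≤ X.card := by
    intro X h1 h2 h3
    refine hA X (Finset.mem_filter.2 ⟨(memF _).2 ⟨h1, h2⟩, ?_⟩)
    have := hmin X h1 h2
    omega
  obtain ⟨hAne, hAS⟩ := (memF _).1 hAF
  have hdual : A.card + (A + S).card ≤ Fintype.card G := by
    have h1 := card_compl_add_add_card_le hsymm A
    have h2 := Finset.card_add_card_compl (A + S)
    have h3 : ((A + S)ᶜ).Nonempty := by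
      rw [Finset.nonempty_iff_ne_empty, Ne, Finset.compl_eq_empty_iff]
      exact hAS
    have h4 : (A + S)ᶜ + S ≠ univ := by
      intro h
      rw [h, Finset.card_univ] at h1
      have := hAne.card_pos
      omega
    have := hmin' _ h3 h4 (by omega)
    omega
  have hinter : ∀ B : Finset G, B.card = A.card → (B + S).card = (A + S).card →
      (A ∩ B).Nonempty → A ⊆ B := by
    intro B hB hBS hne
    by_contra hsub
    have hlt : (A ∩ B).card < A.card := by
      apply Finset.card_lt_card
      refine Finset.ssubset_iff_subset_ne.2 ⟨Finset.inter_subset_left, fun h => hsub ?_⟩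
      exact Finset.inter_eq_left.1 h
    have h1 : A ∩ B + S ≠ univ := by
      intro h
      apply hAS
      rw [Finset.eq_univ_iff_forall] at h ⊢
      exact fun x => Finset.add_subset_add_right Finset.inter_subset_left (h x)
    have h2 : ((A + S).card : ℤ) - A.card < (A ∩ B + S).card - (A ∩ B).card := by
      by_contra! h
      have := hmin' _ hne h1 h
      omega
    have h3 := card_inter_add_card_union_add_le A B S
    have h4 := Finset.card_union_add_card_inter A B
    have h5 : A ∪ B + S = univ := by
      by_contra h
      have := hmin _ (hAne.mono Finset.subset_union_left) h
      omega
    rw [h5, Finset.card_univ] at h3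
    have := hne.card_pos
    omega
  have htrans : ∀ a ∈ A, ∀ b ∈ A, ∀ x ∈ A, x + (b - a) ∈ A := by
    intro a ha b hb x hx
    have hs := hinter ({a - b} + A) (Finset.card_singleton_add _ _)
      (by rw [add_assoc, Finset.card_singleton_add])
      ⟨a, Finset.mem_inter.2 ⟨ha, Finset.mem_add.2 ⟨a - b, by simp, b, hb, by abel⟩⟩⟩
    obtain ⟨u, hu, v, hv, huv⟩ := Finset.mem_add.1 (hs hx)
    rw [Finset.mem_singleton] at hu
    have : x + (b - a) = v := by rw [← huv, hu]; abel
    rwa [this]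
  obtain ⟨a₀, ha₀⟩ := hAne
  have memK : ∀ x, x ∈ ({-a₀} : Finset G) + A ↔ x + a₀ ∈ A := by
    intro x
    rw [Finset.mem_add]
    constructor
    · rintro ⟨u, hu, v, hv, rfl⟩
      rw [Finset.mem_singleton] at hu
      have : u + v + a₀ = v := by rw [hu]; abel
      rwa [this]
    · intro h
      exact ⟨-a₀, by simp, x + a₀, h, by abel⟩
  let H : AddSubgroup G :=
    { carrier := {x | x + a₀ ∈ A}
      zero_mem' := by simpa using ha₀
      add_mem' := by
        intro x y hx hy
        have := htrans _ ha₀ _ hy _ hx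
        have e : x + y + a₀ = x + a₀ + (y + a₀ - a₀) := by abel
        simpa only [Set.mem_ofPred_eq, e] using this
      neg_mem' := by
        intro x hx
        have := htrans _ hx _ ha₀ _ ha₀
        have e : -x + a₀ = a₀ + (a₀ - (x + a₀)) := by abel
        simpa only [Set.mem_ofPred_eq, e] using this }
  have hc : ({-a₀} + A + S).card = (A + S).card := by
    rw [add_assoc, Finset.card_singleton_add]
  refine ⟨H, {-a₀} + A, memK, ?_, ?_⟩
  · intro h
    rw [h, Finset.card_univ] at hc
    exact hAS ((Finset.card_eq_iff_eq_univ _).1 hc.symm)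
  · rw [hc, Finset.card_singleton_add]
    have := hmin X₀ hX₀ hX₀S
    omega

/-- If the symmetric sum-free set `S` misses at most `|H| - 2` elements of `S + H`, then the sum of
two elements of `S` lying in different cosets of `H`, or outside `H`, is not congruent to an
element of `S` modulo `H`. -/
theorem add_sub_notMem_of_card_add_le {S K : Finset G} {H : AddSubgroup G}
    (hodd : Odd (Fintype.card G)) (hsymm : ∀ x ∈ S, -x ∈ S)
    (hfree : ∀ x ∈ S, ∀ y ∈ S, x + y ∉ S) (hK : ∀ x, x ∈ K ↔ x ∈ H)
    (hcard : (K + S).card + 2 ≤ K.card + S.card) {a b c : G} (ha : a ∈ S) (hb : b ∈ S)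
    (hc : c ∈ S) (hab : a - b ∉ H ∨ a ∉ H) : a + b - c ∉ H := by
  intro habc
  let C : G → Finset G := fun x => {x} + K
  have memC : ∀ x y, y ∈ C x ↔ y - x ∈ H := by
    intro x y
    simp only [C, Finset.singleton_add, Finset.mem_vadd_finset, vadd_eq_add, hK]
    constructor
    · rintro ⟨z, hz, rfl⟩
      simpa using hz
    · intro h
      exact ⟨y - x, h, by abel⟩
  have cardC : ∀ x, (C x).card = K.card := fun x => Finset.card_singleton_add _ _
  have hSK : S ⊆ K + S := fun x hx =>
    Finset.mem_add.2 ⟨0, (hK 0).2 H.zero_mem, x, hx, zero_add x⟩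
  have hmiss : ((K + S) \ S).card + 2 ≤ K.card := by
    have := Finset.card_sdiff_add_card_eq_card hSK
    omega
  have hsub : ∀ x ∈ S, C x \ S ⊆ (K + S) \ S := by
    intro x hx
    refine Finset.sdiff_subset_sdiff ?_ subset_rfl
    intro y hy
    exact Finset.mem_add.2 ⟨y - x, (hK _).2 ((memC _ _).1 hy), x, hx, by abel⟩
  have hpair : ∀ x ∈ S, ∀ y ∈ S, x - y ∉ H → (C x \ S).card + (C y \ S).card + 2 ≤ K.card := by
    intro x hx y hy hxy
    have hd : Disjoint (C x \ S) (C y \ S) := by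
      rw [Finset.disjoint_left]
      intro z hz hz'
      have h1 := (memC _ _).1 (Finset.mem_sdiff.1 hz).1
      have h2 := (memC _ _).1 (Finset.mem_sdiff.1 hz').1
      have := H.sub_mem h2 h1
      exact hxy (by simpa using this)
    have := Finset.card_le_card (Finset.union_subset (hsub x hx) (hsub y hy))
    rw [Finset.card_union_of_disjoint hd] at this
    omega
  have hbound : (C a \ S).card + (C b \ S).card + 2 ≤ K.card := by
    by_cases h : a - b ∈ H
    · have haH : a ∉ H := hab.resolve_left (not_not.2 h)
      have e : C b = C a := by
        ext z
        rw [memC, memC]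
        constructor
        · intro hz
          have := H.sub_mem hz h
          simpa using this
        · intro hz
          have := H.add_mem hz h
          simpa using this
      have haa : a - -a ∉ H := by
        intro h2
        obtain ⟨k, hk⟩ := hodd
        apply haH
        have h3 : (Fintype.card G) • a = 0 := card_nsmul_eq_zero
        have h4 : a = (Fintype.card G) • a - k • (a - -a) := by
          rw [hk, sub_neg_eq_add, ← two_nsmul, ← mul_nsmul, add_nsmul, one_nsmul]
          abel
        rw [h4, h3, zero_sub]
        exact H.neg_mem (H.nsmul_mem h2 k)
      have hneg : (C a \ S).card ≤ (C (-a) \ S).card := by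
        refine Finset.card_le_card_of_injOn (fun x => -x) ?_ (neg_injective.injOn)
        intro z hz
        have hz := Finset.mem_sdiff.1 (Finset.mem_coe.1 hz)
        refine Finset.mem_coe.2 (Finset.mem_sdiff.2 ⟨(memC _ _).2 ?_, fun h' => hz.2 ?_⟩)
        · have := H.neg_mem ((memC _ _).1 hz.1)
          have e : -z - -a = -(z - a) := by abel
          rwa [e]
        · simpa using hsymm _ h'
      have := hpair a ha (-a) (hsymm a ha) haa
      rw [e]
      omega
    · exact hpair a ha b hb h
  -- pigeonhole in the coset `a + H`
  have hU : C a ⊆ (C a \ S) ∪ (C b \ S).image (fun y => c - y) := by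
    intro z hz
    rw [memC] at hz
    by_cases hzS : z ∈ S
    · refine Finset.mem_union_right _ (Finset.mem_image.2 ⟨c - z, ?_, by abel⟩)
      refine Finset.mem_sdiff.2 ⟨(memC _ _).2 ?_, fun h => ?_⟩
      · have := H.neg_mem (H.add_mem hz habc)
        have e : c - z - b = -(z - a + (a + b - c)) := by abel
        rwa [e]
      · have := hfree _ hzS _ h
        rw [add_sub_cancel] at this
        exact this hc
    · exact Finset.mem_union_left _ (Finset.mem_sdiff.2 ⟨(memC _ _).2 hz, hzS⟩)
  have h1 := Finset.card_le_card hU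
  have h2 := Finset.card_union_le (C a \ S) ((C b \ S).image (fun y => c - y))
  have h3 := Finset.card_image_le (s := C b \ S) (f := fun y => c - y)
  rw [cardC] at h1
  omega

end Isoperimetric

/-- A symmetric sum-free subset of a finite abelian group whose order has no divisor congruent to
`2` modulo `3` contains at most a third of the group. -/
theorem three_mul_card_le {G : Type*} [AddCommGroup G] [Fintype G]
    (hdiv : ∀ d : ℕ, d ∣ Fintype.card G → d % 3 ≠ 2) (S : Finset G)
    (hsymm : ∀ x ∈ S, -x ∈ S) (hfree : ∀ x ∈ S, ∀ y ∈ S, x + y ∉ S) :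
    3 * S.card ≤ Fintype.card G := by
  classical
  induction hN : Fintype.card G using Nat.strong_induction_on generalizing G with
  | _ N ih =>
  subst hN
  rcases S.eq_empty_or_nonempty with rfl | hS
  · simp
  have hodd : Odd (Fintype.card G) := by
    rw [← Nat.not_even_iff_odd, even_iff_two_dvd]
    exact fun h => hdiv 2 h rfl
  have hdisj : Disjoint (S + S) S := by
    rw [Finset.disjoint_left]
    intro x hx
    obtain ⟨u, hu, v, hv, rfl⟩ := Finset.mem_add.1 hx
    exact hfree u hu v hv
  have hle : (S + S).card + S.card ≤ Fintype.card G := by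
    rw [← Finset.card_union_of_disjoint hdisj]
    exact Finset.card_le_univ _
  have hmod := hdiv _ dvd_rfl
  by_contra! hlt
  have hSS : S + S ≠ univ := by
    intro h
    rw [h, Finset.card_univ] at hle
    have := hS.card_pos
    omega
  obtain ⟨H, K, hK, hKS, hcard⟩ := exists_addSubgroup_card_add_le hsymm hS hSS
  have hcard2 : (K + S).card + 2 ≤ K.card + S.card := by omega
  have key := fun {a b c : G} (ha : a ∈ S) (hb : b ∈ S) (hc : c ∈ S) =>
    add_sub_notMem_of_card_add_le hodd hsymm hfree hK hcard2 ha hb hc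
  have hKH : K.card = Fintype.card H := (Fintype.card_of_subtype K hK).symm
  have hprod : Fintype.card G = Fintype.card (G ⧸ H) * Fintype.card H := by
    simpa only [Nat.card_eq_fintype_card] using H.card_eq_card_quotient_mul_card_addSubgroup
  have hSle : S.card ≤ (K + S).card := Finset.card_le_card fun x hx =>
    Finset.mem_add.2 ⟨0, (hK 0).2 H.zero_mem, x, hx, zero_add x⟩
  have hH2 : 2 ≤ Fintype.card H := by omega
  by_cases hSH : ∃ h ∈ S, h ∈ H
  · obtain ⟨h, hhS, hhH⟩ := hSH
    have hall : ∀ a ∈ S, a ∈ H := by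
      intro a ha
      by_contra haH
      refine key ha hhS ha (Or.inr haH) ?_
      simpa using hhH
    have hHlt : Fintype.card H < Fintype.card G := by
      rw [← hKH]
      by_contra! hge
      have hKu : K = univ :=
        (Finset.card_eq_iff_eq_univ K).1 (le_antisymm (Finset.card_le_univ _) hge)
      apply hKS
      rw [hKu]
      obtain ⟨s, hs⟩ := hS
      refine Finset.eq_univ_iff_forall.2 fun x =>
        Finset.mem_add.2 ⟨x - s, Finset.mem_univ _, s, hs, by abel⟩
    have := ih _ hHlt (G := H) (fun d hd => hdiv d (hd.trans (hprod ▸ dvd_mul_left _ _)))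
      (S.subtype (· ∈ H))
      (fun x hx => by
        rw [Finset.mem_subtype] at hx ⊢
        exact hsymm _ hx)
      (fun x hx y hy => by
        rw [Finset.mem_subtype] at hx hy ⊢
        exact hfree _ hx _ hy) rfl
    rw [Finset.card_subtype, Finset.filter_true_of_mem hall] at this
    omega
  · push Not at hSH
    have hqpos : 0 < Fintype.card (G ⧸ H) := Fintype.card_pos
    have hqlt : Fintype.card (G ⧸ H) < Fintype.card G := by
      rw [hprod]
      nlinarith
    have hT := ih _ hqlt (G := G ⧸ H)
      (fun d hd => hdiv d (hd.trans (hprod ▸ dvd_mul_right _ _)))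
      (S.image (QuotientAddGroup.mk : G → G ⧸ H))
      (fun x hx => by
        obtain ⟨a, ha, rfl⟩ := Finset.mem_image.1 hx
        exact Finset.mem_image.2 ⟨-a, hsymm a ha, rfl⟩)
      (fun x hx y hy hxy => by
        obtain ⟨a, ha, rfl⟩ := Finset.mem_image.1 hx
        obtain ⟨b, hb, rfl⟩ := Finset.mem_image.1 hy
        obtain ⟨c, hc, habc⟩ := Finset.mem_image.1 hxy
        refine key ha hb hc (Or.inr (hSH a ha)) ?_
        rw [← QuotientAddGroup.mk_add, QuotientAddGroup.eq] at habc
        have e : a + b - c = -c + (a + b) := by abel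
        rwa [e]) rfl
    have hfib : S.card ≤ Fintype.card H * (S.image (QuotientAddGroup.mk : G → G ⧸ H)).card := by
      refine Finset.card_le_mul_card_image S _ fun q hq => ?_
      obtain ⟨a, ha, rfl⟩ := Finset.mem_image.1 hq
      rw [← hKH]
      refine Finset.card_le_card_of_injOn (fun x => -a + x) ?_ (add_right_injective _).injOn
      intro x hx
      have hx := (Finset.mem_filter.1 (Finset.mem_coe.1 hx)).2
      exact Finset.mem_coe.2 ((hK _).2 (QuotientAddGroup.eq.1 hx.symm))
    rw [hprod] at hlt
    nlinarith

end SumFree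

/-- In a `3`-independent set, a vanishing signed sum of three elements has signs summing to `0`. -/
theorem IsTIndep.sum_coeff_eq_zero {G : Type*} [AddCommGroup G] {A : Finset G}
    (hA : IsTIndep 3 A) {x y z : G} (hx : x ∈ A) (hy : y ∈ A) (hz : z ∈ A) {p q r : ℤ}
    (hp : |p| ≤ 1) (hq : |q| ≤ 1) (hr : |r| ≤ 1) (h : p • x + q • y + r • z = 0) :
    p + q + r = 0 := by
  classical
  let c : G → ℤ := fun w =>
    (if w = x then p else 0) + (if w = y then q else 0) + (if w = z then r else 0)
  have hc : ∀ w, c w = 0 := by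
    refine hA c ?_ ?_ ?_
    · intro w hw
      have h1 : w ≠ x := fun h => hw (h ▸ hx)
      have h2 : w ≠ y := fun h => hw (h ▸ hy)
      have h3 : w ≠ z := fun h => hw (h ▸ hz)
      simp [c, h1, h2, h3]
    · calc ∑ w ∈ A, |c w| ≤ ∑ w ∈ A, ((if w = x then |p| else 0) + (if w = y then |q| else 0)
            + (if w = z then |r| else 0)) := by
            refine Finset.sum_le_sum fun w _ => (abs_add_three _ _ _).trans (le_of_eq ?_)
            simp only [apply_ite abs, abs_zero]
        _ = |p| + |q| + |r| := by simp [Finset.sum_add_distrib, hx, hy, hz]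
        _ ≤ ((3 : ℕ) : ℤ) := by push_cast; omega
    · simpa [c, add_smul, ite_smul, Finset.sum_add_distrib, hx, hy, hz] using h
  have hsum : ∑ w ∈ A, c w = p + q + r := by simp [c, Finset.sum_add_distrib, hx, hy, hz]
  rw [← hsum]
  exact Finset.sum_eq_zero fun w _ => hc w

theorem stmt7 {G : Type*} [AddCommGroup G] [Fintype G]
    (hn : 2 ≤ Fintype.card G)
    (hdiv : ∀ d : ℕ, d ∣ Fintype.card G → d % 3 ≠ 2) :
    ∀ A : Finset G, IsTIndep 3 A → (A.card : ℚ) ≤ (Fintype.card G : ℚ) / 6 := by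
  classical
  intro A hA
  have hmem : ∀ x, x ∈ A ∪ A.image (fun a => -a) ↔
      ∃ a ∈ A, ∃ p : ℤ, (p = 1 ∨ p = -1) ∧ x = p • a := by
    intro x
    simp only [Finset.mem_union, Finset.mem_image]
    constructor
    · rintro (h | ⟨a, ha, rfl⟩)
      · exact ⟨x, h, 1, Or.inl rfl, by simp⟩
      · exact ⟨a, ha, -1, Or.inr rfl, by simp⟩
    · rintro ⟨a, ha, p, rfl | rfl, rfl⟩
      · left; simpa using ha
      · right; exact ⟨a, ha, by simp⟩
  have hdisj : Disjoint A (A.image fun a => -a) := by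
    rw [Finset.disjoint_left]
    intro x hx hx'
    obtain ⟨y, hy, rfl⟩ := Finset.mem_image.1 hx'
    have := hA.sum_coeff_eq_zero hx hy hy (p := 1) (q := 1) (r := 0) (by simp) (by simp) (by simp)
      (by simp)
    omega
  have hcard := SumFree.three_mul_card_le hdiv (A ∪ A.image fun a => -a)
    (by
      intro x hx
      rw [hmem] at hx ⊢
      obtain ⟨a, ha, p, hp, rfl⟩ := hx
      exact ⟨a, ha, -p, by omega, by simp⟩)
    (by
      intro x hx y hy hxy
      rw [hmem] at hx hy hxy
      obtain ⟨a, ha, p, hp, rfl⟩ := hx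
      obtain ⟨b, hb, q, hq, rfl⟩ := hy
      obtain ⟨c, hc, r, hr, hrc⟩ := hxy
      have := hA.sum_coeff_eq_zero ha hb hc (p := p) (q := q) (r := -r)
        (abs_le.2 (by omega)) (abs_le.2 (by omega)) (abs_le.2 (by omega)) (by rw [hrc]; simp)
      omega)
  rw [Finset.card_union_of_disjoint hdisj, Finset.card_image_of_injective _ neg_injective] at hcard
  have h6 : 6 * A.card ≤ Fintype.card G := by omega
  rw [le_div_iff₀ (by norm_num)]
  have : ((6 * A.card : ℕ) : ℚ) ≤ (Fintype.card G : ℚ) := by exact_mod_cast h6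
  push_cast at this
  linarith
end

section
/- Let G be a finite abelian group of order n ≥ 2, suppose that n has at least one divisor congruent to 2 modulo 3, and let p be the smallest such divisor. Then every 3-independent subset A of G satisfies |A| ≤ (1 + 1/p)·n/6. -/
open scoped Pointwise

/-- A `t`-independent set admits no vanishing signed sum of at most `t` of its elements whose
signs do not add up to zero. -/
lemma IsTIndep.sum_zsmul_ne_zero {G ι : Type*} [AddCommGroup G] [Fintype ι] {t : ℕ}
    {A : Finset G} (hA : IsTIndep t A) (hι : Fintype.card ι ≤ t) (f : ι → G) (e : ι → ℤ)
    (hf : ∀ i, f i ∈ A) (he : ∀ i, |e i| ≤ 1) (hsum : ∑ i, e i ≠ 0) :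
    ∑ i, e i • f i ≠ 0 := by
  classical
  intro h0
  refine hsum ?_
  have key := hA (fun x => ∑ i, if f i = x then e i else 0) ?_ ?_ ?_
  · have h1 : ∑ x ∈ A, ∑ i, (if f i = x then e i else 0) = 0 :=
      Finset.sum_eq_zero fun x _ => key x
    rw [Finset.sum_comm] at h1
    simpa [hf] using h1
  · intro x hx
    refine Finset.sum_eq_zero fun i _ => if_neg ?_
    rintro rfl
    exact hx (hf i)
  · calc ∑ x ∈ A, |∑ i, if f i = x then e i else 0|
        ≤ ∑ x ∈ A, ∑ i, |if f i = x then e i else 0| :=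
          Finset.sum_le_sum fun x _ => Finset.abs_sum_le_sum_abs _ _
      _ = ∑ i, |e i| := by
          rw [Finset.sum_comm]
          simp [apply_ite abs, hf]
      _ ≤ ∑ _i : ι, (1 : ℤ) := Finset.sum_le_sum fun i _ => he i
      _ ≤ t := by simpa using hι
  · simp only [Finset.sum_smul, ite_smul, zero_smul]
    rw [Finset.sum_comm]
    simpa [hf] using h0

section Kneser

variable {G : Type*} [AddCommGroup G]

/-- The set `C` is a union of cosets of the subgroup `H`. -/
def IsPeriodic (H : AddSubgroup G) (C : Finset G) : Prop :=
  ∀ h ∈ H, ∀ x ∈ C, h + x ∈ C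

lemma IsPeriodic.add_mem_iff {H : AddSubgroup G} {C : Finset G} (hC : IsPeriodic H C)
    {h x : G} (hh : h ∈ H) : h + x ∈ C ↔ x ∈ C :=
  ⟨fun hx => by simpa using hC (-h) (H.neg_mem hh) _ hx, hC h hh x⟩

lemma IsPeriodic.card_dvd {H : AddSubgroup G} {C : Finset G} (hC : IsPeriodic H C) :
    Nat.card H ∣ C.card := by
  classical
  have h1 : ((↑) : G → G ⧸ H) ⁻¹' (((↑) : G → G ⧸ H) '' (C : Set G)) = (C : Set G) := by
    refine Set.Subset.antisymm ?_ (Set.subset_preimage_image _ _)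
    rintro x ⟨y, hy, hxy⟩
    have := hC _ (QuotientAddGroup.eq.mp hxy) y hy
    simpa using this
  have h2 := Nat.card_congr (QuotientAddGroup.preimageMkEquivAddSubgroupProdSet H
    (((↑) : G → G ⧸ H) '' (C : Set G)))
  rw [h1, Nat.card_prod] at h2
  rw [show C.card = Nat.card (C : Set G) by simp, h2]
  exact dvd_mul_right _ _

variable [Fintype G]

/-- Within a coset of `H₁ + H₂`, the difference of an `H₁`-periodic and an `H₂`-periodic set is
a product up to the multiplicity `|H₁ ∩ H₂|`. -/
lemma card_mul_card_le_card_sdiff_mul [DecidableEq G] {H₁ H₂ : AddSubgroup G} {C₁ C₂ : Finset G}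
    (h₁ : IsPeriodic H₁ C₁) (h₂ : IsPeriodic H₂ C₂) (g : G) :
    Nat.card {b : H₂ // (b : G) + g ∈ C₁} * Nat.card {a : H₁ // (a : G) + g ∉ C₂} ≤
      (C₁ \ C₂).card * Nat.card (H₁ ⊓ H₂ : AddSubgroup G) := by
  classical
  have hmem : ∀ q : {b : H₂ // (b : G) + g ∈ C₁} × {a : H₁ // (a : G) + g ∉ C₂},
      (q.2.1 : G) + (q.1.1 + g) ∈ C₁ \ C₂ := by
    rintro ⟨⟨⟨b, hb⟩, hb'⟩, ⟨⟨a, ha⟩, ha'⟩⟩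
    refine Finset.mem_sdiff.mpr ⟨h₁ a ha _ hb', ?_⟩
    rw [add_left_comm, h₂.add_mem_iff hb]
    exact ha'
  rw [← Nat.card_prod, Nat.card_eq_fintype_card, ← Finset.card_univ, mul_comm]
  refine Finset.card_le_mul_card_image_of_maps_to
    (f := fun q : {b : H₂ // (b : G) + g ∈ C₁} × {a : H₁ // (a : G) + g ∉ C₂} =>
      (q.2.1 : G) + (q.1.1 + g)) (fun q _ => hmem q) _ fun y _ => ?_
  obtain h0 | ⟨q₀, hq₀⟩ := (Finset.univ.filter
    fun q : {b : H₂ // (b : G) + g ∈ C₁} × {a : H₁ // (a : G) + g ∉ C₂} =>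
      (q.2.1 : G) + (q.1.1 + g) = y).eq_empty_or_nonempty
  · rw [h0]
    simp
  · rw [Nat.card_eq_fintype_card, ← Fintype.card_coe]
    rw [Finset.mem_filter] at hq₀
    have hd : ∀ q : {b : H₂ // (b : G) + g ∈ C₁} × {a : H₁ // (a : G) + g ∉ C₂},
        (q.2.1 : G) + (q.1.1 + g) = y → (q.2.1 : G) - q₀.2.1 = q₀.1.1 - q.1.1 := by
      intro q hq
      have := hq.trans hq₀.2.symm
      rw [← add_assoc, ← add_assoc, add_left_inj] at this
      rw [sub_eq_sub_iff_add_eq_add, this, add_comm]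
    refine Fintype.card_le_of_injective
      (fun q => (⟨(q.1.2.1 : G) - q₀.2.1, ?_, ?_⟩ : (H₁ ⊓ H₂ : AddSubgroup G))) ?_
    · exact H₁.sub_mem q.1.2.1.2 q₀.2.1.2
    · rw [hd q.1 (Finset.mem_filter.mp q.2).2]
      exact H₂.sub_mem q₀.1.1.2 q.1.1.1.2
    · intro q q' hqq
      have e1 : (q.1.2.1 : G) - q₀.2.1 = q'.1.2.1 - q₀.2.1 := congrArg Subtype.val hqq
      have e2 := hd q.1 (Finset.mem_filter.mp q.2).2
      have e3 := hd q'.1 (Finset.mem_filter.mp q'.2).2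
      rw [e1, e3, sub_right_inj] at e2
      rw [sub_left_inj] at e1
      exact Subtype.ext (Prod.ext (Subtype.ext (Subtype.ext e2.symm))
        (Subtype.ext (Subtype.ext e1)))

/-- A nonempty subset of `H` stable under translation by a subgroup `K ≤ H` has at least `|K|`
elements. -/
lemma card_le_card_subtype {H K : AddSubgroup G} (hK : K ≤ H) (P : G → Prop)
    (hP : ∀ k ∈ K, ∀ x, P x → P (k + x)) {x : G} (hx : x ∈ H) (hPx : P x) :
    Nat.card K ≤ Nat.card {b : H // P b} := by
  classical
  refine Nat.card_le_card_of_injective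
    (fun k => ⟨⟨k.1 + x, H.add_mem (hK k.2) hx⟩, hP _ k.2 _ hPx⟩) ?_
  intro k k' h
  have : k.1 + x = k'.1 + x := congrArg (fun z => (z.1 : G)) h
  exact Subtype.ext (add_right_cancel this)

lemma card_subtype_add_card_subtype_not {α : Type*} [Finite α] (P : α → Prop) :
    Nat.card {a // P a} + Nat.card {a // ¬ P a} = Nat.card α := by
  classical
  rw [← Nat.card_sum]
  exact Nat.card_congr (Equiv.sumCompl P)

lemma card_lt_card_of_card_sdiff_lt [DecidableEq G] {H₁ H₂ : AddSubgroup G} {C₁ C₂ : Finset G}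
    (h₁ : IsPeriodic H₁ C₁) (h₂ : IsPeriodic H₂ C₂) (hC : ¬ C₁ ⊆ C₂)
    (hlt₁ : (C₁ \ C₂).card + Nat.card (H₁ ⊓ H₂ : AddSubgroup G) < Nat.card H₂)
    (hlt₂ : (C₂ \ C₁).card + Nat.card (H₁ ⊓ H₂ : AddSubgroup G) < Nat.card H₁) :
    Nat.card H₁ < Nat.card H₂ := by
  obtain ⟨g, hg₁, hg₂⟩ := Finset.not_subset.mp hC
  have q₁ := card_mul_card_le_card_sdiff_mul h₁ h₂ g
  have q₂ := card_mul_card_le_card_sdiff_mul h₂ h₁ g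
  rw [inf_comm] at q₂
  have s₁ := card_subtype_add_card_subtype_not fun a : H₁ => (a : G) + g ∈ C₂
  have s₂ := card_subtype_add_card_subtype_not fun b : H₂ => (b : G) + g ∈ C₁
  have kpos : 0 < Nat.card (H₁ ⊓ H₂ : AddSubgroup G) := Nat.card_pos
  have hS : Nat.card (H₁ ⊓ H₂ : AddSubgroup G) ≤ Nat.card {b : H₂ // (b : G) + g ∈ C₁} :=
    card_le_card_subtype inf_le_right (fun b => b + g ∈ C₁)
      (fun k hk x hx => by
        rw [add_assoc]
        exact h₁ k hk.1 _ hx) H₂.zero_mem (by simpa using hg₁)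
  have hX : Nat.card (H₁ ⊓ H₂ : AddSubgroup G) ≤ Nat.card {a : H₁ // (a : G) + g ∉ C₂} :=
    card_le_card_subtype inf_le_left (fun a => a + g ∉ C₂)
      (fun k hk x hx => by
        rw [add_assoc, h₂.add_mem_iff hk.2]
        exact hx) H₁.zero_mem (by simpa using hg₂)
  have hT : Nat.card {a : H₁ // (a : G) + g ∈ C₂} = 0 ∨
      Nat.card (H₁ ⊓ H₂ : AddSubgroup G) ≤ Nat.card {a : H₁ // (a : G) + g ∈ C₂} := by
    rw [or_iff_not_imp_left]
    intro h0
    obtain ⟨⟨a, ha⟩⟩ := (Nat.card_pos_iff.mp (Nat.pos_of_ne_zero h0)).1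
    exact card_le_card_subtype inf_le_left (fun a => a + g ∈ C₂)
      (fun k hk x hx => by
        rw [add_assoc]
        exact h₂ k hk.2 _ hx) a.2 ha
  generalize Nat.card (H₁ ⊓ H₂ : AddSubgroup G) = k at *
  generalize Nat.card {a : H₁ // (a : G) + g ∈ C₂} = T at *
  generalize Nat.card {b : H₂ // (b : G) + g ∈ C₁} = S at *
  generalize Nat.card {a : H₁ // (a : G) + g ∉ C₂} = X at *
  generalize Nat.card {b : H₂ // (b : G) + g ∉ C₁} = Y at *
  generalize Nat.card H₁ = M at *
  generalize Nat.card H₂ = N at *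
  generalize (C₁ \ C₂).card = D₁ at *
  generalize (C₂ \ C₁).card = D₂ at *
  subst s₁ s₂
  obtain rfl | hT := hT
  · have : k * X ≤ D₁ * k := le_trans (Nat.mul_le_mul_right _ hS) q₁
    nlinarith
  · exfalso
    have a₁ : X < Y := by
      obtain ⟨x, rfl⟩ := Nat.exists_eq_add_of_le hX
      obtain ⟨s, rfl⟩ := Nat.exists_eq_add_of_le hS
      have : (k + s) * (k + x) + k * k + k ≤ k * (k + s + Y) := by nlinarith
      by_contra! hc
      nlinarith [Nat.zero_le (s * x)]
    obtain ⟨y, rfl⟩ := Nat.exists_eq_add_of_lt (lt_of_le_of_lt hX a₁)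
    obtain ⟨t, rfl⟩ := Nat.exists_eq_add_of_le hT
    have : (k + t) * (k + y + 1) + k * k + k ≤ k * (k + t + X) := by nlinarith
    nlinarith [Nat.zero_le (t * y)]

/-- Being within `|H|` of size `N` for some period `H` is inherited by unions. -/
lemma exists_isPeriodic_union [DecidableEq G] {N : ℕ} {C₁ C₂ : Finset G}
    (h₁ : ∃ H : AddSubgroup G, IsPeriodic H C₁ ∧ N ≤ C₁.card + Nat.card H)
    (h₂ : ∃ H : AddSubgroup G, IsPeriodic H C₂ ∧ N ≤ C₂.card + Nat.card H) :
    ∃ H : AddSubgroup G, IsPeriodic H (C₁ ∪ C₂) ∧ N ≤ (C₁ ∪ C₂).card + Nat.card H := by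
  by_cases c₁ : C₁ ⊆ C₂
  · rwa [Finset.union_eq_right.mpr c₁]
  by_cases c₂ : C₂ ⊆ C₁
  · rwa [Finset.union_eq_left.mpr c₂]
  obtain ⟨H₁, p₁, n₁⟩ := h₁
  obtain ⟨H₂, p₂, n₂⟩ := h₂
  refine ⟨H₁ ⊓ H₂, fun h hh x hx => ?_, ?_⟩
  · exact Finset.mem_union.mpr ((Finset.mem_union.mp hx).imp (p₁ h hh.1 x) (p₂ h hh.2 x))
  · by_contra! hlt
    have e₁ := Finset.card_sdiff_add_card C₁ C₂
    have e₂ := Finset.card_sdiff_add_card C₂ C₁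
    rw [Finset.union_comm] at e₂
    have l₁ : (C₁ \ C₂).card + Nat.card (H₁ ⊓ H₂ : AddSubgroup G) < Nat.card H₂ := by omega
    have l₂ : (C₂ \ C₁).card + Nat.card (H₁ ⊓ H₂ : AddSubgroup G) < Nat.card H₁ := by omega
    refine lt_asymm (card_lt_card_of_card_sdiff_lt p₁ p₂ c₁ l₁ l₂)
      (card_lt_card_of_card_sdiff_lt p₂ p₁ c₂ ?_ ?_) <;> rwa [inf_comm]

/-- Iterating the Dyson transform, every element of a sumset `A + B` lies in a subset of `A + B`
with a large period. -/
lemma exists_isPeriodic_subset_add [DecidableEq G] (a b : G) :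
    ∀ (m : ℕ) (A B : Finset G), B.card = m → a ∈ A → b ∈ B →
      ∃ C ⊆ A + B, a + b ∈ C ∧ ∃ H : AddSubgroup G, IsPeriodic H C ∧
        A.card + B.card ≤ C.card + Nat.card H := by
  intro m
  induction m using Nat.strong_induction_on with
  | _ m ih =>
    intro A B hBm ha hb
    by_cases hAB : ∀ x ∈ A, ∀ y ∈ B, x + (y - b) ∈ A
    · refine ⟨b +ᵥ A, ?_, ?_, AddAction.stabilizer G A, ?_, ?_⟩
      · intro z hz
        obtain ⟨x, hx, rfl⟩ := Finset.mem_vadd_finset.mp hz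
        rw [vadd_eq_add, add_comm b x]
        exact Finset.add_mem_add hx hb
      · rw [add_comm]
        exact Finset.vadd_mem_vadd_finset ha
      · intro h hh z hz
        obtain ⟨x, hx, rfl⟩ := Finset.mem_vadd_finset.mp hz
        rw [AddAction.mem_stabilizer_iff] at hh
        have : h + x ∈ A := by
          rw [← hh]
          exact Finset.vadd_mem_vadd_finset hx
        rw [vadd_eq_add, add_left_comm]
        exact Finset.vadd_mem_vadd_finset this
      · rw [Finset.card_vadd_finset]
        refine Nat.add_le_add_left ?_ _
        rw [← Fintype.card_coe, ← Nat.card_eq_fintype_card]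
        refine Nat.card_le_card_of_injective
          (fun y => (⟨y.1 - b, ?_⟩ : AddAction.stabilizer G A)) ?_
        · rw [AddAction.mem_stabilizer_iff]
          refine Finset.eq_of_subset_of_card_le ?_ (by simp)
          intro z hz
          obtain ⟨x, hx, rfl⟩ := Finset.mem_vadd_finset.mp hz
          rw [vadd_eq_add, add_comm]
          exact hAB x hx y y.2
        · intro y y' hy
          exact Subtype.ext (sub_left_injective (congrArg Subtype.val hy))
    · push Not at hAB
      obtain ⟨x, hx, y, hy, hxy⟩ := hAB
      have hsub : B.filter (fun y => x + (y - b) ∈ A) ⊂ B :=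
        Finset.filter_ssubset.mpr ⟨y, hy, hxy⟩
      obtain ⟨C, hC, habC, H, hH, hcard⟩ := ih _ (hBm ▸ Finset.card_lt_card hsub)
        (A ∪ ((x - b) +ᵥ B)) (B.filter fun y => x + (y - b) ∈ A) rfl
        (Finset.mem_union_left _ ha) (Finset.mem_filter.mpr ⟨hb, by simpa using hx⟩)
      refine ⟨C, hC.trans ?_, habC, H, hH, le_trans (le_of_eq ?_) hcard⟩
      · intro z hz
        obtain ⟨u, hu, v, hv, rfl⟩ := Finset.mem_add.mp hz
        rw [Finset.mem_filter] at hv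
        obtain hu | hu := Finset.mem_union.mp hu
        · exact Finset.add_mem_add hu hv.1
        · obtain ⟨w, hw, rfl⟩ := Finset.mem_vadd_finset.mp hu
          rw [show ((x - b) +ᵥ w) + v = (x + (v - b)) + w by
            rw [vadd_eq_add]
            abel]
          exact Finset.add_mem_add hv.2 hw
      · have hinter : (A ∩ ((x - b) +ᵥ B)) = (x - b) +ᵥ B.filter (fun y => x + (y - b) ∈ A) := by
          ext z
          simp only [Finset.mem_inter, Finset.mem_vadd_finset, Finset.mem_filter, vadd_eq_add]
          constructor
          · rintro ⟨hz, w, hw, rfl⟩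
            refine ⟨w, ⟨hw, ?_⟩, rfl⟩
            convert hz using 1
            abel
          · rintro ⟨w, ⟨hw, hw'⟩, rfl⟩
            refine ⟨?_, w, hw, rfl⟩
            convert hw' using 1
            abel
        have := Finset.card_union_add_card_inter A ((x - b) +ᵥ B)
        rw [hinter, Finset.card_vadd_finset, Finset.card_vadd_finset] at this
        exact this.symm

/-- **Kneser's addition theorem**, in the form `|A| + |B| ≤ |A + B| + |H|` for a period `H` of
`A + B`. -/
lemma exists_isPeriodic_add [DecidableEq G] {A B : Finset G} (hA : A.Nonempty)
    (hB : B.Nonempty) :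
    ∃ H : AddSubgroup G, IsPeriodic H (A + B) ∧
      A.card + B.card ≤ (A + B).card + Nat.card H := by
  have hC : ∀ z ∈ A + B, ∃ C ⊆ A + B, z ∈ C ∧ ∃ H : AddSubgroup G, IsPeriodic H C ∧
      A.card + B.card ≤ C.card + Nat.card H := by
    intro z hz
    obtain ⟨a, ha, b, hb, rfl⟩ := Finset.mem_add.mp hz
    exact exists_isPeriodic_subset_add a b _ A B rfl ha hb
  choose! C hsub hmem hper using hC
  have hunion : (A + B).sup' (hA.add hB) C = A + B := by
    refine le_antisymm (Finset.sup'_le _ _ hsub) fun z hz => ?_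
    exact Finset.le_sup' C hz (hmem z hz)
  rw [← hunion]
  exact Finset.sup'_induction (p := fun C => ∃ H : AddSubgroup G, IsPeriodic H C ∧
    A.card + B.card ≤ C.card + Nat.card H) (hA.add hB) C
    (fun _ h₁ _ h₂ => exists_isPeriodic_union h₁ h₂) hper

end Kneser

/-- The Diananda–Yap bound on sum-free sets in a finite abelian group, where `p` is a lower bound
for the divisors of the order that are congruent to `2` modulo `3`. -/
lemma three_mul_card_le_of_disjoint_add {G : Type*} [AddCommGroup G] [Fintype G] [DecidableEq G]
    {p : ℕ} (hmin : ∀ d : ℕ, d ∣ Fintype.card G → d % 3 = 2 → p ≤ d) (B : Finset G)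
    (hB : Disjoint (B + B) B) : 3 * p * B.card ≤ (p + 1) * Fintype.card G := by
  classical
  obtain ⟨M, hM, hmax⟩ := (Finset.univ.filter fun B : Finset G =>
    Disjoint (B + B) B).exists_max_image Finset.card ⟨B, by simpa using hB⟩
  simp only [Finset.mem_filter, Finset.mem_univ, true_and] at hM hmax
  refine le_trans (Nat.mul_le_mul_left _ (hmax B hB)) ?_
  obtain rfl | hne := M.eq_empty_or_nonempty
  · simp
  obtain ⟨H, hH, hcard⟩ := exists_isPeriodic_add hne hne
  have hMper : IsPeriodic H M := by
    have hle : M ⊆ Finset.univ.filter (fun x => ∃ h ∈ H, h + x ∈ M) := fun x hx => by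
      simpa using ⟨0, H.zero_mem, by simpa using hx⟩
    have hfree : Disjoint (Finset.univ.filter (fun x => ∃ h ∈ H, h + x ∈ M) +
        Finset.univ.filter (fun x => ∃ h ∈ H, h + x ∈ M))
        (Finset.univ.filter (fun x => ∃ h ∈ H, h + x ∈ M)) := by
      rw [Finset.disjoint_left]
      intro z hz hz'
      obtain ⟨x, hx, y, hy, rfl⟩ := Finset.mem_add.mp hz
      obtain ⟨h₁, hh₁, hx⟩ := (Finset.mem_filter.mp hx).2
      obtain ⟨h₂, hh₂, hy⟩ := (Finset.mem_filter.mp hy).2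
      obtain ⟨h₃, hh₃, hxy⟩ := (Finset.mem_filter.mp hz').2
      refine Finset.disjoint_left.mp hM ?_ hxy
      have := hH (h₃ - h₁ - h₂) (H.sub_mem (H.sub_mem hh₃ hh₁) hh₂) _ (Finset.add_mem_add hx hy)
      convert this using 1
      abel
    have heq := Finset.eq_of_subset_of_card_le hle (hmax _ hfree)
    intro h hh x hx
    rw [heq, Finset.mem_filter]
    exact ⟨Finset.mem_univ _, -h, H.neg_mem hh, by simpa using hx⟩
  have hdisj : (M + M).card + M.card ≤ Fintype.card G := by
    rw [← Finset.card_union_of_disjoint hM]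
    exact Finset.card_le_univ _
  obtain ⟨k, hk⟩ := hMper.card_dvd
  obtain ⟨m, hm⟩ := H.card_addSubgroup_dvd_card
  rw [Nat.card_eq_fintype_card] at hm
  have hmdvd : m ∣ Fintype.card G := ⟨_, hm.trans (mul_comm _ _)⟩
  have hpos : 0 < Nat.card H := Nat.card_pos
  have h3 : 3 * k ≤ m + 1 := by
    refine Nat.le_of_mul_le_mul_left ?_ hpos
    linarith
  suffices 3 * p * k ≤ (p + 1) * m by
    rw [hk, hm]
    calc 3 * p * (Nat.card H * k) = Nat.card H * (3 * p * k) := by ring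
      _ ≤ Nat.card H * ((p + 1) * m) := Nat.mul_le_mul_left _ this
      _ = (p + 1) * (Nat.card H * m) := by ring
  by_cases hm2 : m % 3 = 2
  · have := hmin m hmdvd hm2
    nlinarith
  · have : 3 * k ≤ m := by omega
    nlinarith

theorem stmt8 {G : Type*} [AddCommGroup G] [Fintype G]
    (hn : 2 ≤ Fintype.card G) (p : ℕ)
    (hp : p ∣ Fintype.card G) (hp2 : p % 3 = 2)
    (hmin : ∀ d : ℕ, d ∣ Fintype.card G → d % 3 = 2 → p ≤ d) :
    ∀ A : Finset G, IsTIndep 3 A →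
      (A.card : ℚ) ≤ (1 + 1 / (p : ℚ)) * (Fintype.card G : ℚ) / 6 := by
  classical
  intro A hA
  have hsign : ∀ x ∈ A ∪ -A, ∃ a ∈ A, ∃ e : ℤ, (e = 1 ∨ e = -1) ∧ x = e • a := by
    intro x hx
    obtain hx | hx := Finset.mem_union.mp hx
    · exact ⟨x, hx, 1, by simp⟩
    · exact ⟨-x, Finset.mem_neg'.mp hx, -1, by simp⟩
  have hdisj : Disjoint A (-A) := by
    rw [Finset.disjoint_left]
    intro a ha ha'
    refine hA.sum_zsmul_ne_zero (ι := Fin 2) (by simp) ![a, -a] ![1, 1] ?_ ?_ ?_ ?_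
    · simpa [Fin.forall_fin_two, ha] using ha'
    · simp [Fin.forall_fin_two]
    · simp
    · simp
  have hfree : Disjoint ((A ∪ -A) + (A ∪ -A)) (A ∪ -A) := by
    rw [Finset.disjoint_left]
    intro z hz hz'
    obtain ⟨x, hx, y, hy, rfl⟩ := Finset.mem_add.mp hz
    obtain ⟨a, ha, e, he, rfl⟩ := hsign _ hx
    obtain ⟨b, hb, f, hf, rfl⟩ := hsign _ hy
    obtain ⟨c, hc, g, hg, habc⟩ := hsign _ hz'
    refine hA.sum_zsmul_ne_zero (ι := Fin 3) (by simp) ![a, b, c] ![e, f, -g] ?_ ?_ ?_ ?_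
    · simp [Fin.forall_fin_succ, ha, hb, hc]
    · obtain rfl | rfl := he <;> obtain rfl | rfl := hf <;> obtain rfl | rfl := hg <;>
        simp [Fin.forall_fin_succ]
    · simp only [Fin.sum_univ_three, Matrix.cons_val]
      omega
    · simp [Fin.sum_univ_three, habc]
  have key := three_mul_card_le_of_disjoint_add hmin _ hfree
  rw [Finset.card_union_of_disjoint hdisj, Finset.card_neg] at key
  have hp0 : (0 : ℚ) < p := by
    have : 0 < p := by omega
    exact_mod_cast this
  have key' : (3 * p * (A.card + A.card) : ℚ) ≤ (p + 1) * Fintype.card G := by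
    exact_mod_cast key
  rw [show (1 + 1 / (p : ℚ)) * (Fintype.card G : ℚ) / 6 = (p + 1) * Fintype.card G / (6 * p) by
    field_simp, le_div_iff₀ (by positivity)]
  linarith
end

section
/- For every ε > 0 and δ > 0 there exists N such that for all n ≥ N: (1/√8 - ε)·√n ≤ s(Z_n, 4) ≤ (1/√2 + δ)·√n, and (1/√15 - ε)·√n ≤ s(Z_n, 5) ≤ (1/√2 + δ)·√n. -/
section PrimesInShortIntervals

open MeasureTheory Filter Topology FourierTransform

theorem integral_fourier_mul_eq {f g : ℝ → ℂ} (hf : Integrable f) (hg : Integrable g) :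
    ∫ t, 𝓕 f t * g t = ∫ u, f u * 𝓕 g u := by
  have := VectorFourier.integral_fourierIntegral_smul_eq_flip (μ := volume) (ν := volume)
    (L := innerₗ ℝ) Real.continuous_fourierChar continuous_inner hf hg
  simp only [flip_innerₗ, smul_eq_mul] at this
  exact this

theorem fourier_exp_mul (φ : ℝ → ℂ) (y u : ℝ) :
    𝓕 (fun t : ℝ ↦ Complex.exp ((2 * Real.pi * y * t : ℝ) * Complex.I) * φ t) u =
      𝓕 φ (u - y) := by
  rw [Real.fourier_real_eq_integral_exp_smul, Real.fourier_real_eq_integral_exp_smul]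
  congr 1 with t
  rw [smul_eq_mul, smul_eq_mul, ← mul_assoc, ← Complex.exp_add]
  congr 2
  push_cast
  ring

/-- A Wiener–Ikehara type statement: if the Laplace transform of a bounded function `h` extends
continuously to the closed half plane, then `h` averages to zero against kernels whose Fourier
transform has compact support. -/
theorem tendsto_integral_mul_fourier_sub {h : ℝ → ℂ} (hm : Measurable h) {B : ℝ}
    (hB : ∀ u, ‖h u‖ ≤ B) (h0 : ∀ u ≤ 0, h u = 0) {G : ℂ → ℂ}
    (hG : ContinuousOn G {w | 0 ≤ w.re})
    (hL : ∀ w : ℂ, 0 < w.re → ∫ u : ℝ, h u * Complex.exp (-w * u) = G w)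
    {φ : ℝ → ℂ} (hφ : Continuous φ) (hc : HasCompactSupport φ) (hi : Integrable (𝓕 φ)) :
    Tendsto (fun y : ℝ ↦ ∫ u, h u * 𝓕 φ (u - y)) atTop (𝓝 0) := by
  have hφi : Integrable φ := hφ.integrable_of_hasCompactSupport hc
  have hB0 : 0 ≤ B := (norm_nonneg _).trans (hB 0)
  set H : ℝ → ℝ → ℂ := fun σ u ↦ h u * Complex.exp (-(σ * u : ℝ)) with hH
  have hHnorm (σ u : ℝ) (hσ : 0 ≤ σ) : ‖H σ u‖ ≤ B := by
    rw [hH]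
    dsimp only
    rcases le_or_gt u 0 with hu | hu
    · simp [h0 u hu, hB0]
    · rw [norm_mul, Complex.norm_exp]
      have : Real.exp (-((σ * u : ℝ) : ℂ)).re ≤ 1 := by
        rw [Real.exp_le_one_iff]
        simp only [Complex.neg_re, Complex.ofReal_re]
        nlinarith
      calc _ ≤ B * 1 := mul_le_mul (hB u) this (Real.exp_nonneg _) hB0
        _ = B := mul_one B
  have hHm (σ : ℝ) : Measurable (H σ) := by
    rw [hH]
    fun_prop
  have hHi (σ : ℝ) (hσ : 0 < σ) : Integrable (H σ) := by
    have h1 : IntegrableOn (H σ) (Set.Ioi 0) := by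
      refine Integrable.mono' ((exp_neg_integrableOn_Ioi 0 hσ).const_mul B)
        (hHm σ).aestronglyMeasurable (Eventually.of_forall fun u ↦ ?_)
      rw [hH]
      dsimp only
      rw [norm_mul, Complex.norm_exp]
      have : (-((σ * u : ℝ) : ℂ)).re = -σ * u := by simp
      rw [this]
      exact mul_le_mul_of_nonneg_right (hB u) (Real.exp_nonneg _)
    have h2 : Set.indicator (Set.Ioi 0) (H σ) = H σ := by
      rw [Set.indicator_eq_self]
      intro u hu
      by_contra hu'
      exact hu (by simp [hH, h0 u (not_lt.mp hu')])
    rw [← h2]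
    exact h1.integrable_indicator measurableSet_Ioi
  have hHf (σ t : ℝ) (hσ : 0 < σ) : 𝓕 (H σ) t = G (σ + 2 * Real.pi * t * Complex.I) := by
    rw [← hL _ (by simpa using hσ), Real.fourier_real_eq_integral_exp_smul]
    congr 1 with u
    rw [hH, smul_eq_mul]
    dsimp only
    rw [mul_left_comm, ← Complex.exp_add]
    congr 2
    push_cast
    ring
  have key (y : ℝ) : ∫ u, h u * 𝓕 φ (u - y) =
      𝓕 (fun t : ℝ ↦ φ t * G (2 * Real.pi * t * Complex.I)) (-y) := by
    set e : ℝ → ℂ := fun t ↦ Complex.exp ((2 * Real.pi * y * t : ℝ) * Complex.I) with he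
    have he1 (t : ℝ) : ‖e t‖ = 1 := by rw [he]; exact Complex.norm_exp_ofReal_mul_I _
    have hec : Continuous e := by rw [he]; fun_prop
    have heφ : Integrable (fun t ↦ e t * φ t) :=
      (hec.mul hφ).integrable_of_hasCompactSupport hc.mul_left
    have eq1 (σ : ℝ) (hσ : 0 < σ) : ∫ u, H σ u * 𝓕 φ (u - y) =
        ∫ t : ℝ, G (σ + 2 * Real.pi * t * Complex.I) * (e t * φ t) := by
      have := integral_fourier_mul_eq (hHi σ hσ) heφ
      simp_rw [he, fourier_exp_mul, hHf σ _ hσ] at this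
      exact this.symm
    have lim1 : Tendsto (fun σ : ℝ ↦ ∫ u, H σ u * 𝓕 φ (u - y)) (𝓝[>] 0)
        (𝓝 (∫ u, h u * 𝓕 φ (u - y))) := by
      have hi' : Integrable (fun u ↦ 𝓕 φ (u - y)) := hi.comp_sub_right y
      refine tendsto_integral_filter_of_dominated_convergence (fun u ↦ B * ‖𝓕 φ (u - y)‖)
        (Eventually.of_forall fun σ ↦
          (hHm σ).aestronglyMeasurable.mul hi'.aestronglyMeasurable) ?_
        (hi'.norm.const_mul B) (Eventually.of_forall fun u ↦ ?_)
      · filter_upwards [self_mem_nhdsWithin] with σ hσ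
        refine Eventually.of_forall fun u ↦ ?_
        rw [norm_mul]
        exact mul_le_mul_of_nonneg_right (hHnorm σ u (le_of_lt hσ)) (norm_nonneg _)
      · have hcont : Continuous (fun σ : ℝ ↦ H σ u * 𝓕 φ (u - y)) := by
          rw [hH]
          fun_prop
        have := (hcont.tendsto 0).mono_left (nhdsWithin_le_nhds (s := Set.Ioi 0))
        simpa [hH] using this
    have lim2 : Tendsto
        (fun σ : ℝ ↦ ∫ t : ℝ, G (σ + 2 * Real.pi * t * Complex.I) * (e t * φ t)) (𝓝[>] 0)
        (𝓝 (∫ t : ℝ, G (2 * Real.pi * t * Complex.I) * (e t * φ t))) := by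
      have hcomp : IsCompact ((fun p : ℝ × ℝ ↦ (p.1 + 2 * Real.pi * p.2 * Complex.I : ℂ)) ''
          (Set.Icc 0 1 ×ˢ tsupport φ)) := (isCompact_Icc.prod hc).image (by fun_prop)
      have hsub : ((fun p : ℝ × ℝ ↦ (p.1 + 2 * Real.pi * p.2 * Complex.I : ℂ)) ''
          (Set.Icc 0 1 ×ˢ tsupport φ)) ⊆ {w | 0 ≤ w.re} := by
        rintro _ ⟨p, hp, rfl⟩
        simpa using hp.1.1
      obtain ⟨C, hC⟩ := hcomp.exists_bound_of_continuousOn (hG.mono hsub)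
      have hline (σ : ℝ) (hσ : 0 ≤ σ) :
          Continuous fun t : ℝ ↦ G (σ + 2 * Real.pi * t * Complex.I) :=
        hG.comp_continuous (by fun_prop) fun t ↦ by simpa using hσ
      refine tendsto_integral_filter_of_dominated_convergence (fun t ↦ C * ‖φ t‖)
        ?_ ?_ (hφi.norm.const_mul C) (Eventually.of_forall fun t ↦ ?_)
      · filter_upwards [self_mem_nhdsWithin] with σ hσ
        exact ((hline σ (le_of_lt hσ)).mul (hec.mul hφ)).aestronglyMeasurable
      · filter_upwards [Ioo_mem_nhdsGT (zero_lt_one' ℝ)] with σ hσ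
        refine Eventually.of_forall fun t ↦ ?_
        rw [norm_mul, norm_mul, he1, one_mul]
        by_cases ht : t ∈ tsupport φ
        · exact mul_le_mul_of_nonneg_right
            (hC _ ⟨(σ, t), ⟨⟨hσ.1.le, hσ.2.le⟩, ht⟩, rfl⟩) (norm_nonneg _)
        · simp [image_eq_zero_of_notMem_tsupport ht]
      · refine Tendsto.mul_const _ ?_
        have hw : ContinuousWithinAt G {w | 0 ≤ w.re} (2 * Real.pi * t * Complex.I) :=
          hG _ (by simp)
        refine hw.tendsto.comp (tendsto_nhdsWithin_iff.mpr ⟨?_, ?_⟩)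
        · have hcont : Continuous fun σ : ℝ ↦ (σ + 2 * Real.pi * t * Complex.I : ℂ) := by fun_prop
          have := (hcont.tendsto 0).mono_left (nhdsWithin_le_nhds (s := Set.Ioi 0))
          simpa using this
        · filter_upwards [self_mem_nhdsWithin] with σ hσ
          simpa using le_of_lt (Set.mem_Ioi.mp hσ)
    have lim2' := lim2.congr' (f₂ := fun σ : ℝ ↦ ∫ u, H σ u * 𝓕 φ (u - y)) (by
      filter_upwards [self_mem_nhdsWithin] with σ hσ
      exact (eq1 σ hσ).symm)
    rw [tendsto_nhds_unique lim1 lim2', Real.fourier_real_eq_integral_exp_smul]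
    congr 1 with t
    rw [he, smul_eq_mul]
    dsimp only
    rw [mul_left_comm, mul_comm (G _), mul_assoc, mul_comm (φ t), mul_assoc]
    congr 3
    · push_cast
      ring
  simp_rw [key]
  have := (Real.zero_at_infty_fourier
    (fun t : ℝ ↦ φ t * G (2 * Real.pi * t * Complex.I)))
  exact this.comp (tendsto_neg_atTop_atBot.mono_right atBot_le_cocompact)

theorem psi_exp_mul_exp_neg_le (u : ℝ) :
    Chebyshev.psi (Real.exp u) * Real.exp (-u) ≤ Real.log 4 + 4 := by
  have := Chebyshev.psi_le_const_mul_self (Real.exp_pos u).le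
  rw [Real.exp_neg, ← div_eq_mul_inv, div_le_iff₀ (Real.exp_pos u)]
  exact this

theorem psi_exp_mul_exp_neg_nonneg (u : ℝ) :
    0 ≤ Chebyshev.psi (Real.exp u) * Real.exp (-u) :=
  mul_nonneg (Chebyshev.psi_nonneg _) (Real.exp_nonneg _)

theorem measurable_psi_exp_mul_exp_neg :
    Measurable fun u : ℝ ↦ Chebyshev.psi (Real.exp u) * Real.exp (-u) :=
  (Chebyshev.psi_mono.measurable.comp Real.measurable_exp).mul
    (Real.measurable_exp.comp measurable_neg)

theorem LSeries_vonMangoldt_eq_mul_integral {s : ℂ} (hs : 1 < s.re) :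
    LSeries (fun n ↦ (ArithmeticFunction.vonMangoldt n : ℂ)) s =
      s * ∫ u in Set.Ioi (0 : ℝ), (Chebyshev.psi (Real.exp u) * Real.exp (-u) : ℝ) *
        Complex.exp (-(s - 1) * u) := by
  have hsum (x : ℝ) : ∑ k ∈ Finset.Icc 1 ⌊x⌋₊, ArithmeticFunction.vonMangoldt k =
      Chebyshev.psi x := rfl
  rw [LSeries_eq_mul_integral_of_nonneg _ zero_le_one hs]
  · congr 1
    rw [← Real.exp_zero, ← integral_comp_exp_Ioi]
    refine setIntegral_congr_fun measurableSet_Ioi fun u _ ↦ ?_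
    rw [← Complex.ofReal_sum, hsum, Complex.ofReal_exp,
      Complex.cpow_def_of_ne_zero (Complex.exp_ne_zero _), ← Complex.ofReal_exp,
      ← Complex.ofReal_log (Real.exp_pos u).le, Real.log_exp, Complex.real_smul]
    push_cast
    rw [mul_left_comm, mul_assoc, ← Complex.exp_add, ← Complex.exp_add]
    congr 2
    ring
  · refine Asymptotics.IsBigO.of_bound (Real.log 4 + 4) (Eventually.of_forall fun n ↦ ?_)
    have h1 : ∑ k ∈ Finset.Icc 1 n, ArithmeticFunction.vonMangoldt k = Chebyshev.psi n := by
      rw [← hsum, Nat.floor_natCast]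
    rw [h1, Real.rpow_one, Real.norm_of_nonneg (Chebyshev.psi_nonneg _),
      Real.norm_of_nonneg (Nat.cast_nonneg n)]
    exact Chebyshev.psi_le_const_mul_self (Nat.cast_nonneg n)
  · exact fun n ↦ ArithmeticFunction.vonMangoldt_nonneg

theorem exists_continuousOn_integral_psi_sub_one :
    ∃ G : ℂ → ℂ, ContinuousOn G {w | 0 ≤ w.re} ∧ ∀ w : ℂ, 0 < w.re →
      ∫ u : ℝ, (Set.indicator (Set.Ioi (0 : ℝ)) (fun u : ℝ ↦
        ((Chebyshev.psi (Real.exp u) * Real.exp (-u) - 1 : ℝ) : ℂ)) u) * Complex.exp (-w * u) =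
        G w := by
  refine ⟨fun w ↦
    (ArithmeticFunction.vonMangoldt.LFunctionResidueClassAux (1 : ZMod 1) (1 + w) - 1) / (1 + w), ?_, fun w hw ↦ ?_⟩
  · refine ContinuousOn.div (ContinuousOn.sub ?_ continuousOn_const) (by fun_prop) ?_
    · refine (ArithmeticFunction.vonMangoldt.continuousOn_LFunctionResidueClassAux
        (1 : ZMod 1)).comp (by fun_prop) fun w hw ↦ ?_
      simpa using hw
    · intro w hw h
      have := congrArg Complex.re h
      simp at this hw
      linarith
  · have hw0 : w ≠ 0 := by
      rintro rfl
      simp at hw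
    have hw1 : 1 + w ≠ 0 := by
      intro h
      have := congrArg Complex.re h
      simp at this
      linarith
    have hs : 1 < (1 + w).re := by simpa using hw
    have h1 := ArithmeticFunction.vonMangoldt.eqOn_LFunctionResidueClassAux
      (isUnit_one (M := ZMod 1)) hs
    have h2 : (fun n ↦ (ArithmeticFunction.vonMangoldt.residueClass (1 : ZMod 1) n : ℂ)) =
        fun n ↦ (ArithmeticFunction.vonMangoldt n : ℂ) := by
      ext n
      rw [ArithmeticFunction.vonMangoldt.residueClass, Set.indicator_of_mem]
      exact Subsingleton.elim (α := ZMod 1) _ _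
    simp only [h2, LSeries_vonMangoldt_eq_mul_integral hs, add_sub_cancel_left,
      Nat.totient_one, Nat.cast_one, inv_one] at h1
    dsimp only
    rw [h1]
    have h3 : ∫ u in Set.Ioi (0 : ℝ), Complex.exp (-w * u) = 1 / w := by
      rw [integral_exp_mul_complex_Ioi (by simpa using hw)]
      simp
    have hE : IntegrableOn (fun u : ℝ ↦ Complex.exp (-w * u)) (Set.Ioi 0) :=
      integrableOn_exp_mul_complex_Ioi (by simpa using hw) 0
    have hP : IntegrableOn (fun u : ℝ ↦ ((Chebyshev.psi (Real.exp u) * Real.exp (-u) : ℝ) : ℂ) *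
        Complex.exp (-w * u)) (Set.Ioi 0) := by
      refine Integrable.bdd_mul (c := Real.log 4 + 4) hE
        (Complex.measurable_ofReal.comp measurable_psi_exp_mul_exp_neg).aestronglyMeasurable
        (Eventually.of_forall fun u ↦ ?_)
      rw [Complex.norm_real, Real.norm_of_nonneg (psi_exp_mul_exp_neg_nonneg u)]
      exact psi_exp_mul_exp_neg_le u
    have h4 : ∀ u : ℝ, Set.indicator (Set.Ioi (0 : ℝ)) (fun u : ℝ ↦
        ((Chebyshev.psi (Real.exp u) * Real.exp (-u) - 1 : ℝ) : ℂ)) u * Complex.exp (-w * u) =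
        Set.indicator (Set.Ioi (0 : ℝ)) (fun u : ℝ ↦
          ((Chebyshev.psi (Real.exp u) * Real.exp (-u) : ℝ) : ℂ) *
            Complex.exp (-w * u) - Complex.exp (-w * u)) u := by
      intro u
      by_cases hu : u ∈ Set.Ioi (0 : ℝ)
      · rw [Set.indicator_of_mem hu, Set.indicator_of_mem hu]
        push_cast
        ring
      · rw [Set.indicator_of_notMem hu, Set.indicator_of_notMem hu, zero_mul]
    simp_rw [h4]
    rw [integral_indicator measurableSet_Ioi, integral_sub hP hE, h3]
    field_simp
    ring

theorem fourier_comp_mul_inv (φ : ℝ → ℂ) {l : ℝ} (hl : 0 < l) (u : ℝ) :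
    𝓕 (fun t : ℝ ↦ φ (l⁻¹ * t)) u = l * 𝓕 φ (l * u) := by
  rw [Real.fourier_real_eq_integral_exp_smul, Real.fourier_real_eq_integral_exp_smul]
  have := Measure.integral_comp_mul_left
    (fun t : ℝ ↦ Complex.exp (↑(-2 * Real.pi * t * (l * u)) * Complex.I) • φ t) l⁻¹
  rw [inv_inv, abs_of_pos hl, Complex.real_smul] at this
  rw [← this]
  congr 1 with t
  congr 4
  field_simp

/-- Continuous, compactly supported functions whose Fourier transforms have integral one and are
concentrated near the origin. -/
theorem exists_fourier_concentrated {d κ : ℝ} (hd : 0 < d) (hκ : 0 < κ) :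
    ∃ φ : ℝ → ℂ, Continuous φ ∧ HasCompactSupport φ ∧ Integrable (𝓕 φ) ∧ ∫ v, 𝓕 φ v = 1 ∧
      ∫ v in {v : ℝ | d < |v|}, ‖𝓕 φ v‖ ≤ κ := by
  let b : ContDiffBump (0 : ℝ) := ⟨1, 2, one_pos, one_lt_two⟩
  set φ : ℝ → ℂ := fun t ↦ (b t : ℂ) with hφ
  have hφd : ContDiff ℝ (⊤ : ℕ∞) φ := Complex.ofRealCLM.contDiff.comp b.contDiff
  have hφc : HasCompactSupport φ := b.hasCompactSupport.comp_left (g := Complex.ofReal) rfl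
  have hφi : Integrable φ := hφd.continuous.integrable_of_hasCompactSupport hφc
  have hKi : Integrable (𝓕 φ) := by
    have := (𝓕 (hφc.toSchwartzMap hφd) : SchwartzMap ℝ ℂ).integrable (μ := volume)
    rwa [SchwartzMap.fourier_coe] at this
  have hone : ∫ v, 𝓕 φ v = 1 := by
    have h1 := congrFun (hφd.continuous.fourierInv_fourier_eq hφi hKi) 0
    rw [Real.fourierInv_eq'] at h1
    have h2 : φ 0 = 1 := by
      rw [hφ]
      simp only [Complex.ofReal_eq_one]
      exact b.one_of_mem_closedBall (by simp [b])
    simpa [h2] using h1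
  have hms (r : ℝ) : MeasurableSet {v : ℝ | r < |v|} :=
    measurableSet_lt measurable_const continuous_abs.measurable
  have htail : Tendsto (fun r : ℝ ↦ ∫ v in {v : ℝ | r < |v|}, ‖𝓕 φ v‖) atTop (𝓝 0) := by
    have h := tendsto_setIntegral_of_antitone (μ := volume) (f := fun v ↦ ‖𝓕 φ v‖)
      (s := fun r : ℝ ↦ {v : ℝ | r < |v|}) hms
      (fun r r' h v hv ↦ lt_of_le_of_lt h hv) ⟨0, hKi.norm.integrableOn⟩
    have he : ⋂ r : ℝ, {v : ℝ | r < |v|} = ∅ := by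
      ext v
      simp only [Set.mem_iInter, Set.mem_ofPred_eq, Set.mem_empty_iff_false, iff_false, not_forall]
      exact ⟨|v|, lt_irrefl _⟩
    rwa [he, setIntegral_empty] at h
  obtain ⟨r, hr, hr0⟩ := ((htail.eventually_le_const hκ).and (eventually_gt_atTop 0)).exists
  set l := r / d with hl
  have hl0 : 0 < l := div_pos hr0 hd
  have hF : 𝓕 (fun t : ℝ ↦ φ (l⁻¹ * t)) = fun u ↦ (l : ℂ) * 𝓕 φ (l * u) :=
    funext fun u ↦ fourier_comp_mul_inv φ hl0 u
  refine ⟨fun t ↦ φ (l⁻¹ * t), hφd.continuous.comp (by fun_prop),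
    hφc.comp_homeomorph (Homeomorph.mulLeft₀ l⁻¹ (inv_ne_zero hl0.ne')), ?_, ?_, ?_⟩
  · rw [hF]
    exact (hKi.comp_mul_left' hl0.ne').const_mul _
  · rw [hF, integral_const_mul, Measure.integral_comp_mul_left, hone, abs_of_pos (inv_pos.mpr hl0),
      Complex.real_smul, mul_one, ← Complex.ofReal_mul, mul_inv_cancel₀ hl0.ne',
      Complex.ofReal_one]
  · rw [hF, ← integral_indicator (hms d)]
    rw [← integral_indicator (hms r)] at hr
    have h := Measure.integral_comp_mul_left
      (Set.indicator {v : ℝ | r < |v|} fun v ↦ ‖𝓕 φ v‖) l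
    refine le_trans (le_of_eq ?_) hr
    have h2 : ∀ v : ℝ, Set.indicator {v : ℝ | d < |v|} (fun v ↦ ‖(l : ℂ) * 𝓕 φ (l * v)‖) v =
        l * Set.indicator {v : ℝ | r < |v|} (fun v ↦ ‖𝓕 φ v‖) (l * v) := by
      intro v
      have : d < |v| ↔ r < |l * v| := by
        rw [abs_mul, abs_of_pos hl0, hl, div_mul_eq_mul_div, lt_div_iff₀ hd,
          mul_lt_mul_iff_right₀ hr0]
      simp only [Set.indicator_apply, Set.mem_ofPred_eq, this, norm_mul, Complex.norm_real,
        Real.norm_of_nonneg hl0.le]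
      split_ifs <;> simp
    simp_rw [h2]
    rw [integral_const_mul, h, abs_of_pos (inv_pos.mpr hl0), smul_eq_mul, ← mul_assoc,
      mul_inv_cancel₀ hl0.ne', one_mul]

theorem integrable_psi_mul_fourier_sub {φ : ℝ → ℂ} (hi : Integrable (𝓕 φ)) (y : ℝ) :
    Integrable fun u : ℝ ↦
      ((Chebyshev.psi (Real.exp u) * Real.exp (-u) : ℝ) : ℂ) * 𝓕 φ (u - y) := by
  refine Integrable.bdd_mul (c := Real.log 4 + 4) (hi.comp_sub_right y)
    (Complex.measurable_ofReal.comp measurable_psi_exp_mul_exp_neg).aestronglyMeasurable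
    (Eventually.of_forall fun u ↦ ?_)
  rw [Complex.norm_real, Real.norm_of_nonneg (psi_exp_mul_exp_neg_nonneg u)]
  exact psi_exp_mul_exp_neg_le u

theorem tendsto_integral_psi_mul_fourier_sub {φ : ℝ → ℂ} (hφ : Continuous φ)
    (hc : HasCompactSupport φ) (hi : Integrable (𝓕 φ)) (h1 : ∫ v, 𝓕 φ v = 1) :
    Tendsto (fun y : ℝ ↦ ∫ u : ℝ,
      ((Chebyshev.psi (Real.exp u) * Real.exp (-u) : ℝ) : ℂ) * 𝓕 φ (u - y)) atTop (𝓝 1) := by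
  obtain ⟨G, hG, hL⟩ := exists_continuousOn_integral_psi_sub_one
  have hlog : 0 < Real.log 4 := Real.log_pos (by norm_num)
  have hm : Measurable (Set.indicator (Set.Ioi (0 : ℝ)) (fun u : ℝ ↦
      ((Chebyshev.psi (Real.exp u) * Real.exp (-u) - 1 : ℝ) : ℂ))) :=
    (Complex.measurable_ofReal.comp (measurable_psi_exp_mul_exp_neg.sub_const 1)).indicator
      measurableSet_Ioi
  have hB (u : ℝ) : ‖Set.indicator (Set.Ioi (0 : ℝ)) (fun u : ℝ ↦
      ((Chebyshev.psi (Real.exp u) * Real.exp (-u) - 1 : ℝ) : ℂ)) u‖ ≤ Real.log 4 + 4 := by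
    refine (norm_indicator_le_norm_self _ _).trans ?_
    rw [Complex.norm_real, Real.norm_eq_abs, abs_le]
    constructor <;> linarith [psi_exp_mul_exp_neg_nonneg u, psi_exp_mul_exp_neg_le u]
  have lim1 := tendsto_integral_mul_fourier_sub hm hB
    (fun u hu ↦ Set.indicator_of_notMem (by simpa using hu) _) hG hL hφ hc hi
  have lim2 : Tendsto (fun y : ℝ ↦ ∫ v, Set.indicator (Set.Ioi (-y)) (𝓕 φ) v) atTop (𝓝 1) := by
    rw [← h1]
    refine tendsto_integral_filter_of_dominated_convergence (fun v ↦ ‖𝓕 φ v‖)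
      (Eventually.of_forall fun y ↦ hi.aestronglyMeasurable.indicator measurableSet_Ioi)
      (Eventually.of_forall fun y ↦ Eventually.of_forall fun v ↦ norm_indicator_le_norm_self _ _)
      hi.norm (Eventually.of_forall fun v ↦ ?_)
    refine tendsto_const_nhds.congr' ?_
    filter_upwards [eventually_gt_atTop (-v)] with y hy
    rw [Set.indicator_of_mem (by simp; linarith)]
  have := lim1.add lim2
  rw [zero_add] at this
  refine this.congr fun y ↦ ?_
  rw [← integral_sub_right_eq_self (Set.indicator (Set.Ioi (-y)) (𝓕 φ)) y, ← integral_add]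
  · congr 1 with u
    by_cases hu : 0 < u
    · rw [Set.indicator_of_mem (by simpa using hu), Set.indicator_of_mem (by simpa using hu)]
      push_cast
      ring
    · have h0 : Chebyshev.psi (Real.exp u) = 0 :=
        Chebyshev.psi_eq_zero_of_le_one (Real.exp_le_one_iff.mpr (not_lt.mp hu))
      rw [Set.indicator_of_notMem (by simpa using hu), Set.indicator_of_notMem (by simpa using hu),
        h0]
      simp
  · exact Integrable.bdd_mul (hi.comp_sub_right y) hm.aestronglyMeasurable
      (Eventually.of_forall hB)
  · exact (hi.indicator measurableSet_Ioi).comp_sub_right y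

theorem Chebyshev.theta_eq_of_forall_not_prime {a b : ℝ} (hab : a ≤ b)
    (h : ∀ p : ℕ, p.Prime → a < p → b < p) : Chebyshev.theta b = Chebyshev.theta a := by
  unfold Chebyshev.theta
  congr 1
  ext p
  simp only [Finset.mem_filter, Finset.mem_Ioc]
  refine ⟨fun ⟨⟨h0, h1⟩, hp⟩ ↦ ⟨⟨h0, ?_⟩, hp⟩, fun ⟨⟨h0, h1⟩, hp⟩ ↦
    ⟨⟨h0, h1.trans (Nat.floor_le_floor hab)⟩, hp⟩⟩
  by_contra hlt
  have h2 : (p : ℝ) ≤ b := (Nat.le_floor_iff' hp.ne_zero).mp h1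
  exact absurd (h p hp ((Nat.floor_lt' hp.ne_zero).mp (not_le.mp hlt))) (not_lt.mpr h2)

/-- A consequence of the prime number theorem: short multiplicative intervals contain primes. -/
theorem eventually_exists_prime_mem_Ioc_mul {η : ℝ} (hη : 0 < η) :
    ∀ᶠ x : ℝ in atTop, ∃ p : ℕ, p.Prime ∧ x < p ∧ p ≤ (1 + η) * x := by
  obtain ⟨C₀, hC₀⟩ := Chebyshev.psi_sub_theta_le_mul_sqrt
  set C := max C₀ 0 with hC
  have hC0 : 0 ≤ C := le_max_right _ _
  set B := Real.log 4 + 4 with hB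
  have hB0 : 0 < B := by
    have : 0 < Real.log 4 := Real.log_pos (by norm_num)
    linarith
  set d := Real.log (1 + η) / 3 with hd
  have hd0 : 0 < d := div_pos (Real.log_pos (by linarith)) three_pos
  set ε := 1 - Real.exp (-d) with hε
  have hε0 : 0 < ε := by
    have : Real.exp (-d) < 1 := Real.exp_lt_one_iff.mpr (by linarith)
    linarith
  obtain ⟨φ, hφ, hc, hi, h1, ht⟩ := exists_fourier_concentrated hd0
    (show 0 < ε / (4 * B) by positivity)
  set f : ℝ → ℝ := fun u ↦ Chebyshev.psi (Real.exp u) * Real.exp (-u) with hf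
  set D : ℝ → ℂ := fun y ↦ ∫ u : ℝ, (f u : ℂ) * 𝓕 φ (u - y) with hD
  have hDlim : Tendsto D atTop (𝓝 1) := tendsto_integral_psi_mul_fourier_sub hφ hc hi h1
  have lim1 : Tendsto (fun y ↦ ‖D (y + d) - Real.exp (-d) * D y‖) atTop (𝓝 ε) := by
    have := ((hDlim.comp (tendsto_atTop_add_const_right _ d tendsto_id)).sub
      (hDlim.const_mul (Real.exp (-d) : ℂ))).norm
    have he : ‖(1 : ℂ) - Real.exp (-d) * 1‖ = ε := by
      rw [mul_one, ← Complex.ofReal_one, ← Complex.ofReal_sub, Complex.norm_real,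
        Real.norm_of_nonneg hε0.le]
    rwa [he] at this
  have lim2 : Tendsto (fun y : ℝ ↦ C * Real.exp (-(y / 2)) * ∫ v, ‖𝓕 φ v‖) atTop (𝓝 0) := by
    have h : Tendsto (fun y : ℝ ↦ Real.exp (-(y / 2))) atTop (𝓝 0) :=
      Real.tendsto_exp_neg_atTop_nhds_zero.comp (tendsto_id.atTop_div_const two_pos)
    simpa using (h.const_mul C).mul_const (∫ v, ‖𝓕 φ v‖)
  have hu : Tendsto (fun x : ℝ ↦ Real.log x + d) atTop atTop :=
    tendsto_atTop_add_const_right _ d Real.tendsto_log_atTop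
  filter_upwards [hu.eventually (lim1.eventually_const_lt (show ε / 2 < ε by linarith)),
    hu.eventually (lim2.eventually_lt_const (show 0 < ε / 4 by linarith)),
    eventually_gt_atTop 0] with x hx1 hx2 hx0
  by_contra hno
  push Not at hno
  set y := Real.log x + d with hy
  have hgB (w : ℝ) : |f (w + d) - Real.exp (-d) * f w| ≤ B := by
    have h1 := psi_exp_mul_exp_neg_nonneg (w + d)
    have h2 := psi_exp_mul_exp_neg_le (w + d)
    have h3 := psi_exp_mul_exp_neg_nonneg w
    have h4 := psi_exp_mul_exp_neg_le w
    have h5 := Real.exp_pos (-d)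
    have h6 : Real.exp (-d) * f w ≤ 1 * B := mul_le_mul (by linarith) h4 h3 zero_le_one
    have h7 : 0 ≤ Real.exp (-d) * f w := mul_nonneg h5.le h3
    rw [abs_le]
    constructor <;> linarith
  have hgA (v : ℝ) (hv : |v| ≤ d) :
      |f (v + y + d) - Real.exp (-d) * f (v + y)| ≤ C * Real.exp (-(y / 2)) := by
    obtain ⟨hv1, hv2⟩ := abs_le.mp hv
    set w := v + y with hw
    have hle : Real.exp w ≤ Real.exp (w + d) := Real.exp_le_exp.mpr (by linarith)
    have hlow : x ≤ Real.exp w := by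
      rw [← Real.log_le_iff_le_exp hx0]
      linarith
    have hupp : Real.exp (w + d) ≤ (1 + η) * x := by
      rw [← Real.le_log_iff_exp_le (by positivity), Real.log_mul (by linarith) hx0.ne']
      linarith
    have hθ := Chebyshev.theta_eq_of_forall_not_prime hle fun p hp hlt ↦
      hupp.trans_lt (hno p hp (hlow.trans_lt hlt))
    have heq : f (w + d) - Real.exp (-d) * f w = Real.exp (-(w + d)) *
        (Chebyshev.psi (Real.exp (w + d)) - Chebyshev.psi (Real.exp w)) := by
      rw [hf]
      dsimp only
      rw [show Real.exp (-(w + d)) = Real.exp (-d) * Real.exp (-w) by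
        rw [← Real.exp_add]; ring_nf]
      ring
    have hpos : 0 ≤ Chebyshev.psi (Real.exp (w + d)) - Chebyshev.psi (Real.exp w) :=
      sub_nonneg.mpr (Chebyshev.psi_mono hle)
    rw [heq, abs_of_nonneg (mul_nonneg (Real.exp_nonneg _) hpos)]
    have hψ : Chebyshev.psi (Real.exp (w + d)) - Chebyshev.psi (Real.exp w) ≤
        C * Real.exp ((w + d) / 2) := by
      have h2 := Chebyshev.theta_le_psi (Real.exp w)
      have h3 := hC₀ (Real.exp (w + d))
      rw [← Real.exp_half] at h3
      have h4 : C₀ * Real.exp ((w + d) / 2) ≤ C * Real.exp ((w + d) / 2) :=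
        mul_le_mul_of_nonneg_right (le_max_left _ _) (Real.exp_nonneg _)
      linarith
    calc Real.exp (-(w + d)) *
          (Chebyshev.psi (Real.exp (w + d)) - Chebyshev.psi (Real.exp w))
        ≤ Real.exp (-(w + d)) * (C * Real.exp ((w + d) / 2)) :=
          mul_le_mul_of_nonneg_left hψ (Real.exp_nonneg _)
      _ = C * Real.exp (-((w + d) / 2)) := by
          rw [mul_left_comm, ← Real.exp_add]
          congr 2
          ring
      _ ≤ C * Real.exp (-(y / 2)) :=
          mul_le_mul_of_nonneg_left (Real.exp_le_exp.mpr (by linarith)) hC0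
  have hDeq : D (y + d) - Real.exp (-d) * D y =
      ∫ v : ℝ, ((f (v + y + d) - Real.exp (-d) * f (v + y) : ℝ) : ℂ) * 𝓕 φ v := by
    have h_shift_int (z : ℝ) : Integrable fun v : ℝ ↦ (f (v + z) : ℂ) * 𝓕 φ v := by
      simpa only [add_sub_cancel_right] using (integrable_psi_mul_fourier_sub hi z).comp_add_right z
    have hsh (z : ℝ) : D z = ∫ v : ℝ, (f (v + z) : ℂ) * 𝓕 φ v := by
      rw [hD]
      dsimp only
      rw [← integral_add_right_eq_self _ z]
      simp
    rw [hsh, hsh, ← integral_const_mul, ← integral_sub (h_shift_int _) ((h_shift_int _).const_mul _)]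
    congr 1 with v
    rw [← add_assoc]
    push_cast
    ring
  have hms : MeasurableSet {v : ℝ | d < |v|} :=
    measurableSet_lt measurable_const continuous_abs.measurable
  have hbound : ‖D (y + d) - Real.exp (-d) * D y‖ ≤
      C * Real.exp (-(y / 2)) * (∫ v, ‖𝓕 φ v‖) +
        B * ∫ v in {v : ℝ | d < |v|}, ‖𝓕 φ v‖ := by
    rw [hDeq, ← integral_const_mul, ← integral_indicator hms, ← integral_const_mul,
      ← integral_add (hi.norm.const_mul _) ((hi.norm.indicator hms).const_mul _)]
    refine norm_integral_le_of_norm_le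
      ((hi.norm.const_mul _).add ((hi.norm.indicator hms).const_mul _))
      (Eventually.of_forall fun v ↦ ?_)
    rw [norm_mul, Complex.norm_real, Real.norm_eq_abs]
    have hA0 : 0 ≤ C * Real.exp (-(y / 2)) := mul_nonneg hC0 (Real.exp_nonneg _)
    by_cases hv : d < |v|
    · rw [Set.indicator_of_mem (by exact hv)]
      have := mul_le_mul_of_nonneg_right (hgB (v + y)) (norm_nonneg (𝓕 φ v))
      have := mul_nonneg hA0 (norm_nonneg (𝓕 φ v))
      linarith
    · rw [Set.indicator_of_notMem (by exact hv), mul_zero, add_zero]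
      exact mul_le_mul_of_nonneg_right (hgA v (not_lt.mp hv)) (norm_nonneg _)
  have hκ : B * ∫ v in {v : ℝ | d < |v|}, ‖𝓕 φ v‖ ≤ ε / 4 := by
    calc _ ≤ B * (ε / (4 * B)) := mul_le_mul_of_nonneg_left ht hB0.le
      _ = ε / 4 := by field_simp
  linarith

end PrimesInShortIntervals

/-- Ruzsa's construction of a dense Sidon set. -/
theorem exists_sidon_of_prime {p : ℕ} (hp : p.Prime) :
    ∃ S : Finset ℕ, p - 1 ≤ S.card ∧ (∀ a ∈ S, a < p * (p - 1)) ∧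
      ∀ a ∈ S, ∀ b ∈ S, ∀ c ∈ S, ∀ d ∈ S, a + b = c + d → a = c ∨ a = d := by
  have := Fact.mk hp
  obtain ⟨g, hg⟩ := IsCyclic.exists_generator (α := (ZMod p)ˣ)
  have hord : orderOf g = p - 1 := by
    rw [orderOf_eq_card_of_forall_mem_zpowers hg, Nat.card_eq_fintype_card, ZMod.card_units]
  have hcop : (p - 1).Coprime p := by
    have := Nat.coprime_self_sub_left (m := 1) (n := p) hp.one_lt.le
    simpa using this
  have hp1 : p - 1 ≠ 0 := by have := hp.two_le; omega
  refine ⟨(Finset.range (p * (p - 1))).filter fun a ↦ (a : ZMod p) = (g ^ a : (ZMod p)ˣ),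
    ?_, ?_, ?_⟩
  · set f : ℕ → ℕ := fun i ↦ Nat.chineseRemainder hcop i ((g ^ i : (ZMod p)ˣ) : ZMod p).val with hf
    have h1 (i : ℕ) : f i ≡ i [MOD p - 1] := (Nat.chineseRemainder hcop _ _).2.1
    have h2 (i : ℕ) : f i ≡ ((g ^ i : (ZMod p)ˣ) : ZMod p).val [MOD p] :=
      (Nat.chineseRemainder hcop _ _).2.2
    calc p - 1 = (Finset.range (p - 1)).card := (Finset.card_range _).symm
      _ ≤ _ := Finset.card_le_card_of_injOn f ?_ ?_
    · intro i hi
      simp only [Finset.coe_filter, Finset.mem_range, Set.mem_ofPred_eq]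
      refine ⟨?_, ?_⟩
      · rw [mul_comm]
        exact Nat.chineseRemainder_lt_mul hcop _ _ hp1 hp.ne_zero
      · rw [pow_eq_pow_iff_modEq.mpr (hord.symm ▸ h1 i),
          (ZMod.natCast_eq_natCast_iff _ _ _).mpr (h2 i), ZMod.natCast_zmod_val]
    · intro i hi j hj hij
      have : i ≡ j [MOD p - 1] := (h1 i).symm.trans (hij ▸ h1 j)
      exact this.eq_of_lt_of_lt (by simpa using hi) (by simpa using hj)
  · intro a ha
    simpa using (Finset.mem_filter.mp ha).1
  · intro a ha b hb c hc d hd h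
    have key : ∀ u v : ℕ, u < p * (p - 1) → v < p * (p - 1) →
        (u : ZMod p) = (g ^ u : (ZMod p)ˣ) → (v : ZMod p) = (g ^ v : (ZMod p)ˣ) →
        (u : ZMod p) = v → u = v := by
      intro u v hu hv hgu hgv huv
      have h1 : u ≡ v [MOD p] := (ZMod.natCast_eq_natCast_iff _ _ _).mp huv
      have h2 : u ≡ v [MOD p - 1] := by
        rw [← hord, ← pow_eq_pow_iff_modEq]
        exact Units.ext (by rw [← hgu, ← hgv, huv])
      exact ((Nat.modEq_and_modEq_iff_modEq_mul hcop.symm).mp ⟨h1, h2⟩).eq_of_lt_of_lt hu hv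
    simp only [Finset.mem_filter, Finset.mem_range] at ha hb hc hd
    have hsum : (a : ZMod p) + b = c + d := by exact_mod_cast congrArg (Nat.cast (R := ZMod p)) h
    have hprod : (a : ZMod p) * b = c * d := by
      rw [ha.2, hb.2, hc.2, hd.2, ← Units.val_mul, ← Units.val_mul, ← pow_add, ← pow_add, h]
    have h0 : ((a : ZMod p) - c) * (a - d) = 0 := by linear_combination a * hsum - hprod
    rcases mul_eq_zero.mp h0 with h0 | h0
    · exact .inl (key a c ha.1 hc.1 ha.2 hc.2 (sub_eq_zero.mp h0))
    · exact .inr (key a d ha.1 hd.1 ha.2 hd.2 (sub_eq_zero.mp h0))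

theorem multiset_eq_of_sidon {S : Finset ℕ}
    (hS : ∀ a ∈ S, ∀ b ∈ S, ∀ c ∈ S, ∀ d ∈ S, a + b = c + d → a = c ∨ a = d)
    {M N : Multiset ℕ} (hM : ∀ a ∈ M, a ∈ S) (hN : ∀ a ∈ N, a ∈ S) (hc : M.card = N.card)
    (h2 : M.card ≤ 2) (hs : M.sum = N.sum) : M = N := by
  interval_cases h : M.card
  · rw [Multiset.card_eq_zero.mp h, Multiset.card_eq_zero.mp hc.symm]
  · obtain ⟨a, rfl⟩ := Multiset.card_eq_one.mp h
    obtain ⟨b, rfl⟩ := Multiset.card_eq_one.mp hc.symm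
    simpa using hs
  · obtain ⟨a, b, rfl⟩ := Multiset.card_eq_two.mp h
    obtain ⟨c, d, rfl⟩ := Multiset.card_eq_two.mp hc.symm
    simp only [Multiset.insert_eq_cons, Multiset.mem_cons, Multiset.mem_singleton,
      forall_eq_or_imp, forall_eq, Multiset.sum_cons, Multiset.sum_singleton] at hM hN hs
    rcases hS a hM.1 b hM.2 c hN.1 d hN.2 hs with rfl | rfl
    · rw [show b = d by omega]
    · rw [show b = c by omega, Multiset.pair_comm]

theorem isTIndep_image_natCast {n t lo hi : ℕ} {S : Finset ℕ} (ht : t ≤ 5)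
    (hS : ∀ a ∈ S, ∀ b ∈ S, ∀ c ∈ S, ∀ d ∈ S, a + b = c + d → a = c ∨ a = d)
    (hlo : ∀ a ∈ S, lo ≤ a) (hhi : ∀ a ∈ S, a ≤ hi) (hlh : lo ≤ hi) (hn : t * hi < n)
    (hr : (t - 1) / 2 * hi < ((t - 1) / 2 + 1) * lo)
    (hinj : Set.InjOn (Nat.cast : ℕ → ZMod n) S) :
    IsTIndep t (S.image (Nat.cast : ℕ → ZMod n)) := by
  intro c hsupp habs hsum
  rw [Finset.sum_image hinj] at habs hsum
  set e : ℕ → ℤ := fun a ↦ c a with he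
  have hz : ∑ a ∈ S, e a * a = 0 := by
    have hdvd : (n : ℤ) ∣ ∑ a ∈ S, e a * a := by
      rw [← ZMod.intCast_zmod_eq_zero_iff_dvd]
      push_cast
      simpa [zsmul_eq_mul] using hsum
    refine Int.eq_zero_of_abs_lt_dvd hdvd ?_
    calc |∑ a ∈ S, e a * a| ≤ ∑ a ∈ S, |e a * a| := Finset.abs_sum_le_sum_abs _ _
      _ ≤ ∑ a ∈ S, |e a| * hi := Finset.sum_le_sum fun a ha ↦ by
          rw [abs_mul, Nat.abs_cast]
          exact mul_le_mul_of_nonneg_left (by exact_mod_cast hhi a ha) (abs_nonneg _)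
      _ = (∑ a ∈ S, |e a|) * hi := (Finset.sum_mul _ _ _).symm
      _ ≤ t * hi := mul_le_mul_of_nonneg_right habs (Int.natCast_nonneg _)
      _ < n := by exact_mod_cast hn
  set P := ∑ a ∈ S, (e a).toNat with hP
  set Q := ∑ a ∈ S, (-e a).toNat with hQ
  have hPQ : P + Q ≤ t := by
    have : ((P + Q : ℕ) : ℤ) = ∑ a ∈ S, |e a| := by
      rw [hP, hQ, ← Finset.sum_add_distrib]
      push_cast
      exact Finset.sum_congr rfl fun a _ ↦ by rcases abs_cases (e a) with h | h <;> omega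
    have h2 : ((P + Q : ℕ) : ℤ) ≤ t := this ▸ habs
    exact_mod_cast h2
  have hw : ∑ a ∈ S, (e a).toNat * a = ∑ a ∈ S, (-e a).toNat * a := by
    have : ((∑ a ∈ S, (e a).toNat * a : ℕ) : ℤ) - (∑ a ∈ S, (-e a).toNat * a : ℕ) = 0 := by
      rw [← hz]
      push_cast
      rw [← Finset.sum_sub_distrib]
      refine Finset.sum_congr rfl fun a _ ↦ ?_
      rw [← sub_mul]
      congr 1
      omega
    omega
  have hbd (w : ℕ → ℕ) : (∑ a ∈ S, w a) * lo ≤ ∑ a ∈ S, w a * a ∧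
      ∑ a ∈ S, w a * a ≤ (∑ a ∈ S, w a) * hi := by
    rw [Finset.sum_mul, Finset.sum_mul]
    exact ⟨Finset.sum_le_sum fun a ha ↦ Nat.mul_le_mul_left _ (hlo a ha),
      Finset.sum_le_sum fun a ha ↦ Nat.mul_le_mul_left _ (hhi a ha)⟩
  have hne (p q : ℕ) (hpq : p + q ≤ t) (h : p * lo ≤ q * hi) : p ≤ q := by
    by_contra! hlt
    have hq : q ≤ (t - 1) / 2 := by omega
    obtain ⟨r, hr'⟩ := Nat.exists_eq_add_of_le hq
    have h1 : (q + 1) * lo ≤ p * lo := Nat.mul_le_mul_right _ hlt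
    have h2 : r * lo ≤ r * hi := Nat.mul_le_mul_left _ hlh
    rw [hr'] at hr
    nlinarith
  have hPeqQ : P = Q := by
    have h1 := hbd fun a ↦ (e a).toNat
    have h2 := hbd fun a ↦ (-e a).toNat
    exact le_antisymm (hne P Q hPQ (h1.1.trans (hw ▸ h2.2)))
      (hne Q P (by omega) (h2.1.trans (hw ▸ h1.2)))
  set M : (ℕ → ℕ) → Multiset ℕ := fun w ↦ ∑ a ∈ S, Multiset.replicate (w a) a with hM
  have hcard (w : ℕ → ℕ) : (M w).card = ∑ a ∈ S, w a := by simp [hM]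
  have hMsum (w : ℕ → ℕ) : (M w).sum = ∑ a ∈ S, w a * a := by
    rw [hM, ← Multiset.coe_sumAddMonoidHom, map_sum]
    simp
  have hmem (w : ℕ → ℕ) : ∀ a ∈ M w, a ∈ S := by
    intro a ha
    obtain ⟨b, hb, hab⟩ := Multiset.mem_sum.mp ha
    rwa [Multiset.eq_of_mem_replicate hab]
  have hcount (w : ℕ → ℕ) (a : ℕ) (ha : a ∈ S) : (M w).count a = w a := by
    rw [hM, Multiset.count_sum']
    simp [Multiset.count_replicate, ha]
  have hMM : M (fun a ↦ (e a).toNat) = M (fun a ↦ (-e a).toNat) := by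
    refine multiset_eq_of_sidon hS (hmem _) (hmem _) ?_ ?_ ?_
    · rw [hcard, hcard]
      exact hPeqQ
    · rw [hcard]
      change P ≤ 2
      omega
    · rw [hMsum, hMsum, hw]
  intro x
  by_cases hx : x ∈ S.image (Nat.cast : ℕ → ZMod n)
  · obtain ⟨a, ha, rfl⟩ := Finset.mem_image.mp hx
    have h1 := hcount (fun a ↦ (e a).toNat) a ha
    rw [hMM, hcount _ a ha] at h1
    change e a = 0
    omega
  · exact hsupp x hx

theorem bddAbove_card_isTIndep (G : Type*) [AddCommGroup G] [Finite G] (t : ℕ) :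
    BddAbove {m | ∃ A : Finset G, IsTIndep t A ∧ A.card = m} := by
  have := Fintype.ofFinite G
  refine ⟨Fintype.card G, ?_⟩
  rintro _ ⟨A, -, rfl⟩
  exact A.card_le_univ

theorem le_sIndep_zmod {n t lo p : ℕ} (hp : p.Prime) (ht1 : 1 ≤ t) (ht : t ≤ 5)
    (hn : t * (lo + p * p) < n)
    (hr : (t - 1) / 2 * (lo + p * p) < ((t - 1) / 2 + 1) * lo) :
    p - 1 ≤ sIndep (ZMod n) t := by
  have : NeZero n := ⟨by omega⟩
  obtain ⟨S, hc, hlt, hS⟩ := exists_sidon_of_prime hp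
  set T := S.map (addLeftEmbedding lo) with hT
  have hTlo : ∀ a ∈ T, lo ≤ a := by
    intro a ha
    obtain ⟨s, -, rfl⟩ := Finset.mem_map.mp ha
    exact Nat.le_add_right _ _
  have hThi : ∀ a ∈ T, a ≤ lo + p * p := by
    intro a ha
    obtain ⟨s, hs, rfl⟩ := Finset.mem_map.mp ha
    exact Nat.add_le_add_left ((hlt s hs).le.trans (Nat.mul_le_mul_left _ (Nat.sub_le _ _))) _
  have hTS : ∀ a ∈ T, ∀ b ∈ T, ∀ c ∈ T, ∀ d ∈ T, a + b = c + d → a = c ∨ a = d := by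
    simp only [hT, Finset.mem_map, addLeftEmbedding_apply, forall_exists_index, and_imp,
      forall_apply_eq_imp_iff₂, add_right_inj]
    intro a ha b hb c hc d hd h
    exact hS a ha b hb c hc d hd (by omega)
  have hhi : lo + p * p < n := lt_of_le_of_lt (Nat.le_mul_of_pos_left _ ht1) hn
  have hinj : Set.InjOn (Nat.cast : ℕ → ZMod n) T := by
    intro a ha b hb hab
    exact ((ZMod.natCast_eq_natCast_iff _ _ _).mp hab).eq_of_lt_of_lt
      ((hThi a ha).trans_lt hhi) ((hThi b hb).trans_lt hhi)
  refine hc.trans (le_csSup (bddAbove_card_isTIndep _ _) ⟨T.image Nat.cast,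
    isTIndep_image_natCast ht hTS hTlo hThi (Nat.le_add_right _ _) hn hr hinj, ?_⟩)
  rw [Finset.card_image_of_injOn hinj, hT, Finset.card_map]

theorem IsTIndep.two_mul_card_mul_le {G : Type*} [AddCommGroup G] [Fintype G] {t : ℕ}
    (ht : 4 ≤ t) {A : Finset G} (hA : IsTIndep t A) :
    2 * (A.card * (A.card - 1)) ≤ Fintype.card G := by
  classical
  let e := Fintype.equivFin G
  let σ : G × G × Bool → ℤ := fun q ↦ if q.2.2 then 1 else if e q.1 < e q.2.1 then 1 else -1
  let τ : G × G × Bool → ℤ := fun q ↦ if q.2.2 then -1 else if e q.1 < e q.2.1 then 1 else -1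
  let l : G × G × Bool → G → ℤ := fun q x ↦
    (if x = q.1 then σ q else 0) + if x = q.2.1 then τ q else 0
  have hσ (q) : |σ q| = 1 := by simp only [σ]; split_ifs <;> rfl
  have hτ (q) : |τ q| = 1 := by simp only [τ]; split_ifs <;> rfl
  let D : Finset (G × G × Bool) :=
    (A ×ˢ A ×ˢ Finset.univ).filter fun q ↦ q.1 ≠ q.2.1
  have hD : D.card = 2 * (A.card * (A.card - 1)) := by
    have : D = (A.offDiag ×ˢ (Finset.univ : Finset Bool)).map
        (Equiv.prodAssoc G G Bool).toEmbedding := by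
      ext ⟨a, b, s⟩
      simp [D, Finset.mem_map_equiv, and_assoc]
    rw [this, Finset.card_map, Finset.card_product, Finset.offDiag_card, Nat.mul_sub,
      Finset.card_univ, Fintype.card_bool, mul_one, mul_comm]
  have hl (q) (hq : q ∈ D) : ∑ x ∈ A, l q x • x = σ q • q.1 + τ q • q.2.1 := by
    simp only [D, Finset.mem_filter, Finset.mem_product] at hq
    simp [l, add_smul, Finset.sum_add_distrib, ite_smul, hq.1.1, hq.1.2.1]
  have hl1 (q) (hq : q ∈ D) : ∑ x ∈ A, |l q x| ≤ 2 := by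
    simp only [D, Finset.mem_filter, Finset.mem_product] at hq
    calc ∑ x ∈ A, |l q x|
        ≤ ∑ x ∈ A, ((if x = q.1 then 1 else 0) + if x = q.2.1 then 1 else 0) := by
          refine Finset.sum_le_sum fun x _ ↦ (abs_add_le _ _).trans (le_of_eq ?_)
          simp only [apply_ite abs, hσ, hτ, abs_zero]
      _ = 2 := by simp [Finset.sum_add_distrib, hq.1.1, hq.1.2.1]
  have hl0 (q) (hq : q ∈ D) (x) (hx : x ∉ A) : l q x = 0 := by
    simp only [D, Finset.mem_filter, Finset.mem_product] at hq
    have h1 : x ≠ q.1 := fun h ↦ hx (h ▸ hq.1.1)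
    have h2 : x ≠ q.2.1 := fun h ↦ hx (h ▸ hq.1.2.1)
    simp [l, h1, h2]
  rw [← hD, ← Finset.card_univ]
  refine Finset.card_le_card_of_injOn (fun q ↦ σ q • q.1 + τ q • q.2.1)
    (fun _ _ ↦ Finset.mem_coe.mpr (Finset.mem_univ _)) fun q hq r hr hqr ↦ ?_
  have hlr : ∀ x, l q x = l r x := fun x ↦ sub_eq_zero.mp <| hA (fun x ↦ l q x - l r x)
    (fun x hx ↦ by rw [hl0 q hq x hx, hl0 r hr x hx, sub_zero])
    (calc ∑ x ∈ A, |l q x - l r x| ≤ ∑ x ∈ A, (|l q x| + |l r x|) :=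
            Finset.sum_le_sum fun x _ ↦ abs_sub _ _
      _ ≤ t := by
        rw [Finset.sum_add_distrib]
        have h1 := hl1 q hq
        have h2 := hl1 r hr
        omega)
    (by simp only [sub_smul, Finset.sum_sub_distrib, hl q hq, hl r hr]
        exact sub_eq_zero.mpr hqr) x
  obtain ⟨a, b, s⟩ := q
  obtain ⟨c, d, u⟩ := r
  simp only [D, Finset.coe_filter, Set.mem_ofPred_eq] at hq hr
  have hab := hq.2
  have hcd := hr.2
  have ha := hlr a
  have hb := hlr b
  simp only [l, σ, τ] at ha hb
  rcases eq_or_ne a c with rfl | hac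
  · have : b = d := by
      by_contra hbd
      simp only [hab.symm, hbd, if_true, if_false] at hb
      split_ifs at hb <;> omega
    subst this
    cases s <;> cases u <;> simp [hab, hab.symm] at ha hb ⊢ <;> grind
  · have had : a = d := by
      by_contra had
      simp only [hab, hac, had, if_true, if_false] at ha
      split_ifs at ha <;> omega
    have hbc : b = c := by
      by_contra hbc
      simp only [hab.symm, hbc, ← had, if_true, if_false] at hb
      split_ifs at hb <;> omega
    subst had hbc
    have hne : e a ≠ e b := e.injective.ne hab
    exfalso
    cases s <;> cases u <;> simp [hab, hab.symm] at ha hb <;> grind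

theorem two_mul_sIndep_mul_le (G : Type*) [AddCommGroup G] [Fintype G] {t : ℕ} (ht : 4 ≤ t) :
    2 * (sIndep G t * (sIndep G t - 1)) ≤ Fintype.card G := by
  obtain ⟨A, hA, hc⟩ := Nat.sSup_mem (s := {m | ∃ A : Finset G, IsTIndep t A ∧ A.card = m})
    ⟨0, ∅, fun c hc _ _ x ↦ hc x (Finset.notMem_empty x), rfl⟩ (bddAbove_card_isTIndep G t)
  rw [sIndep, ← hc]
  exact hA.two_mul_card_mul_le ht

theorem sIndep_zmod_le {t : ℕ} (ht : 4 ≤ t) {δ : ℝ} (hδ : 0 < δ) :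
    ∀ᶠ n : ℕ in Filter.atTop, (sIndep (ZMod n) t : ℝ) ≤ (1 / √2 + δ) * √n := by
  have hs : Filter.Tendsto (fun n : ℕ ↦ δ * √(n : ℝ)) Filter.atTop Filter.atTop :=
    (Real.tendsto_sqrt_atTop.comp tendsto_natCast_atTop_atTop).const_mul_atTop hδ
  filter_upwards [hs.eventually_ge_atTop 1, Filter.eventually_ge_atTop 1] with n h1 hn
  have : NeZero n := ⟨by omega⟩
  have h := two_mul_sIndep_mul_le (ZMod n) ht
  rw [ZMod.card] at h
  generalize sIndep (ZMod n) t = m at h ⊢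
  rcases m with _ | m
  · rw [Nat.cast_zero]
    positivity
  have h2 : (m : ℝ) ≤ √((n : ℝ) / 2) := by
    refine Real.le_sqrt_of_sq_le ?_
    have : (2 * ((m + 1) * m) : ℝ) ≤ n := by exact_mod_cast h
    nlinarith [Nat.cast_nonneg (α := ℝ) m]
  rw [Real.sqrt_div' _ zero_le_two] at h2
  push_cast
  rw [add_mul, one_div_mul_eq_div]
  linarith

theorem eventually_exists_prime_mul_self_le {k ε : ℝ} (hk : 0 < k) (hε : 0 < ε) (C : ℝ) :
    ∀ᶠ n : ℕ in Filter.atTop, ∃ p : ℕ, p.Prime ∧ (1 / √k - ε) * √n ≤ (p - 1 : ℕ) ∧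
      k * (p * p + C) ≤ n := by
  set r := 1 / √k with hr
  have hr0 : 0 < r := by positivity
  have hrk : k * r ^ 2 = 1 := by
    rw [hr, div_pow, Real.sq_sqrt hk.le, one_pow, mul_one_div_cancel hk.ne']
  obtain ⟨u, hu0, huε, hur⟩ : ∃ u, 0 < u ∧ 4 * u ≤ ε ∧ 4 * u ≤ r :=
    ⟨min ε r / 4, by positivity, by linarith [min_le_left ε r], by linarith [min_le_right ε r]⟩
  have hx0 : 0 < r - 2 * u := by linarith
  have hη : 0 < u / (r - 2 * u) := div_pos hu0 hx0
  have hs : Filter.Tendsto (fun n : ℕ ↦ √(n : ℝ)) Filter.atTop Filter.atTop :=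
    Real.tendsto_sqrt_atTop.comp tendsto_natCast_atTop_atTop
  filter_upwards [(hs.const_mul_atTop hx0).eventually (eventually_exists_prime_mem_Ioc_mul hη),
    (hs.const_mul_atTop hu0).eventually_ge_atTop 1,
    (tendsto_natCast_atTop_atTop.const_mul_atTop (mul_pos hr0 hu0)).eventually_ge_atTop C]
    with n ⟨p, hp, hxp, hpx⟩ h1 h2
  refine ⟨p, hp, ?_, ?_⟩
  · rw [Nat.cast_sub hp.one_lt.le, Nat.cast_one]
    have := mul_le_mul_of_nonneg_right huε (Real.sqrt_nonneg n)
    linarith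
  · have h3 : (p : ℝ) ≤ (r - u) * √n := by
      refine hpx.trans (le_of_eq ?_)
      rw [← mul_assoc, add_mul, div_mul_cancel₀ _ hx0.ne']
      ring
    have h4 : (p : ℝ) * p ≤ (r - u) ^ 2 * n := by
      rw [← sq]
      calc (p : ℝ) ^ 2 ≤ ((r - u) * √n) ^ 2 := pow_le_pow_left₀ p.cast_nonneg h3 2
        _ = _ := by rw [mul_pow, Real.sq_sqrt n.cast_nonneg]
    have h5 : (r - u) ^ 2 * n ≤ (r ^ 2 - r * u) * n :=
      mul_le_mul_of_nonneg_right (by nlinarith) n.cast_nonneg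
    calc k * (p * p + C) ≤ k * (r ^ 2 * n) := mul_le_mul_of_nonneg_left (by linarith) hk.le
      _ = n := by rw [← mul_assoc, hrk, one_mul]

theorem le_sIndep_zmod_four {ε : ℝ} (hε : 0 < ε) :
    ∀ᶠ n : ℕ in Filter.atTop, (1 / √8 - ε) * √n ≤ sIndep (ZMod n) 4 := by
  filter_upwards [eventually_exists_prime_mul_self_le (k := 8) (by norm_num) hε 10]
    with n ⟨p, hp, hle, hpn⟩
  have hpn' : 8 * (p * p + 10) ≤ n := by exact_mod_cast hpn
  generalize hq : p * p = q at hpn'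
  refine hle.trans (Nat.cast_le.mpr (le_sIndep_zmod (lo := n / 8 + 1) hp ?_ ?_ ?_ ?_)) <;>
    norm_num [hq] <;> omega

theorem le_sIndep_zmod_five {ε : ℝ} (hε : 0 < ε) :
    ∀ᶠ n : ℕ in Filter.atTop, (1 / √15 - ε) * √n ≤ sIndep (ZMod n) 5 := by
  filter_upwards [eventually_exists_prime_mul_self_le (k := 15) (by norm_num) hε 10]
    with n ⟨p, hp, hle, hpn⟩
  have hpn' : 15 * (p * p + 10) ≤ n := by exact_mod_cast hpn
  generalize hq : p * p = q at hpn'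
  refine hle.trans (Nat.cast_le.mpr (le_sIndep_zmod (lo := 2 * n / 15 + 1) hp ?_ ?_ ?_ ?_)) <;>
    norm_num [hq] <;> omega

theorem stmt15 (ε δ : ℝ) (hε : 0 < ε) (hδ : 0 < δ) :
    ∃ N : ℕ, ∀ n : ℕ, N ≤ n →
      ((1 / Real.sqrt 8 - ε) * Real.sqrt n ≤ (sIndep (ZMod n) 4 : ℝ) ∧
        (sIndep (ZMod n) 4 : ℝ) ≤ (1 / Real.sqrt 2 + δ) * Real.sqrt n) ∧
      ((1 / Real.sqrt 15 - ε) * Real.sqrt n ≤ (sIndep (ZMod n) 5 : ℝ) ∧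
        (sIndep (ZMod n) 5 : ℝ) ≤ (1 / Real.sqrt 2 + δ) * Real.sqrt n) := by
  exact Filter.eventually_atTop.mp <|
    ((le_sIndep_zmod_four hε).and (sIndep_zmod_le le_rfl hδ)).and
      ((le_sIndep_zmod_five hε).and (sIndep_zmod_le (Nat.le_succ 4) hδ))
end
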